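/- arXiv:math/0403370 — 3 statements merged into one kernel-verified Lean document; each statement's English description precedes it below -/
import Mathlib

section
/- Let R be the quotient of a polynomial ring over a field by a homogeneous prime ideal, m its maximal homogeneous ideal, d = dim R, and assume depth(R_m) ≥ 2. Let I ⊆ R be a normal homogeneous ideal (i.e., I^n = \overline{I^n} for all n) with analytic spread ℓ(I) < d. Then H^0_m(R/I^n) = 0 for all sufficiently large n, and hence lim_{n→∞} λ(H^0_m(R/I^n))/n^d = 0. -/
/-!
STATEMENT 12: Let `R` be the quotient of a polynomial ring over a field by a homogeneous prime
ideal, `m` its maximal homogeneous ideal, `d = dim R`, and assume `depth(R_m) ≥ 2`.  Let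
`I ⊆ R` be a normal homogeneous ideal (i.e. `Iⁿ = \overline{Iⁿ}` for all `n`) with analytic
spread `ℓ(I) < d`.  Then `H⁰_m(R/Iⁿ) = 0` for all sufficiently large `n`, and hence
`lim_{n→∞} λ(H⁰_m(R/Iⁿ))/n^d = 0`.

`R` is modelled as a finitely generated standard ℕ-graded algebra domain over a field `k`;
`m` is the irrelevant ideal; `depth(R_m) ≥ 2` is a length-two regular sequence inside `m`;
the analytic spread is the Krull dimension of the fiber cone `R[It] ⊗_R R/m`; normality of `I`
says every element integral over `Iⁿ` lies in `Iⁿ`.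
-/

open Filter

/-- The zeroth local cohomology module `H⁰_J(M) = {x ∈ M | ∃ n, Jⁿ • x = 0}`. -/
noncomputable def H0 {R M : Type*} [CommRing R] [AddCommGroup M] [Module R M]
    (J : Ideal R) : Submodule R M :=
  ⨆ n : ℕ, Submodule.torsionBySet R M (J ^ n : Ideal R)

/-- `x` is integral over the ideal `N`: it satisfies an equation
`x^n + a₁ x^{n-1} + ⋯ + aₙ = 0` with `aᵢ ∈ N^i`. -/
def IsIntegralOverIdeal {R : Type*} [CommRing R] (N : Ideal R) (x : R) : Prop :=
  ∃ n : ℕ, 0 < n ∧ ∃ a : ℕ → R, (∀ i, 1 ≤ i → i ≤ n → a i ∈ N ^ i) ∧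
    x ^ n + ∑ i ∈ Finset.Icc 1 n, a i * x ^ (n - i) = 0

/-- The analytic spread `ℓ(I)`: the Krull dimension of the fiber cone
`R[It] ⊗_R R/m = R[It]/m·R[It]`. -/
noncomputable def analyticSpread {R : Type*} [CommRing R] (I m : Ideal R) :
    WithBot (WithTop ℕ) :=
  ringKrullDim (↥(reesAlgebra I) ⧸ Ideal.map (algebraMap R ↥(reesAlgebra I)) m)


lemma dim_le_of_int {A B : Type*} [CommRing A] [CommRing B] [Algebra A B] [Algebra.IsIntegral A B] :
    ringKrullDim B ≤ ringKrullDim A := by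
  refine Order.krullDim_le_of_strictMono (PrimeSpectrum.comap (algebraMap A B)) ?_
  intro P Q h
  exact Ideal.IsIntegral.comap_lt_comap (I := P.asIdeal) (J := Q.asIdeal) h

lemma dim_ge_of_int {A B : Type*} [CommRing A] [CommRing B] [Algebra A B] [Algebra.IsIntegral A B]
    (hinj : Function.Injective (algebraMap A B)) :
    ringKrullDim A ≤ ringKrullDim B := by
  refine iSup_le fun l => ?_
  obtain ⟨Q, -, hQ, h⟩ := Ideal.exists_ideal_over_prime_of_isIntegral (S := B)
    (RelSeries.head l).asIdeal ⊥ (by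
      intro x hx
      have : x = 0 := hinj (by simpa using hx)
      simp [this])
  have : Q.LiesOver (RelSeries.head l).asIdeal := ⟨h.symm⟩
  obtain ⟨L, hL, -⟩ := Ideal.exists_ltSeries_of_hasGoingUp l Q
  rw [← hL]
  exact le_iSup (fun l : LTSeries (PrimeSpectrum B) => ((l.length : ℕ∞) : WithBot ℕ∞)) L

lemma height_max (k : Type*) [Field k] (s : ℕ) (M : Ideal (MvPolynomial (Fin s) k)) [hM : M.IsMaximal] :
    M.height = s := by
  induction s with
  | zero =>
    have : ringKrullDim (MvPolynomial (Fin 0) k) = 0 := by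
      rw [MvPolynomial.ringKrullDim_of_isNoetherianRing]; simp
    have h := Ideal.height_le_ringKrullDim_of_ne_top (I := M) hM.ne_top
    rw [this] at h
    simpa using h
  | succ s ih =>
    let e := (MvPolynomial.finSuccEquiv k s).toRingEquiv
    let P : Ideal (Polynomial (MvPolynomial (Fin s) k)) := M.comap (e.symm : _ →+* _)
    have hP : P.IsMaximal := Ideal.comap_isMaximal_of_surjective _ e.symm.surjective
    have h1 : P.height = M.height := RingEquiv.height_comap e.symm M
    have : (P.under (MvPolynomial (Fin s) k)).IsMaximal := by
      have := Polynomial.isMaximal_comap_C_of_isJacobsonRing P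
      exact this
    have : P.LiesOver (P.under (MvPolynomial (Fin s) k)) := ⟨rfl⟩
    rw [← h1, Polynomial.height_eq_height_add_one (P.under (MvPolynomial (Fin s) k)) P, ih]
    simp

lemma dim_quot_prime (k : Type*) [Field k] (s : ℕ) (p : MvPolynomial (Fin s) k) (hp : Prime p) :
    (s : WithBot ℕ∞) ≤ ringKrullDim (MvPolynomial (Fin s) k ⧸ Ideal.span {p}) + 1 := by
  obtain ⟨M, hM, hpM⟩ := Ideal.exists_le_maximal (Ideal.span {p})
    (by rw [Ne, Ideal.span_singleton_eq_top]; exact hp.not_isUnit)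
  have := Ideal.height_le_ringKrullDim_quotient_add_one (p := M) (hpM (Ideal.mem_span_singleton_self p))
  rw [height_max] at this
  exact_mod_cast this

lemma key {A K L : Type*} [CommRing A] [IsDomain A] [UniqueFactorizationMonoid A] [Field K] [Field L]
    [Algebra A K] [IsFractionRing A K] [Algebra A L] [Algebra K L] [IsScalarTower A K L]
    (y : L) (h0 : ∃ g : A, g ≠ 0 ∧ IsIntegral A (g • y))
    (h : ∀ p : A, Prime p → ∃ g, ¬ p ∣ g ∧ IsIntegral A (g • y)) : IsIntegral A y := by
  have hy : IsIntegral K y := by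
    obtain ⟨g, hg, hgy⟩ := h0
    have hg' : algebraMap A K g ≠ 0 := by simpa using hg
    have h1 : IsIntegral K (g • y) := hgy.tower_top
    have := h1.smul ((algebraMap A K g)⁻¹)
    rwa [← algebraMap_smul K g y, smul_smul, inv_mul_cancel₀ hg', one_smul] at this
  have hco : ∀ g : A, g ≠ 0 → IsIntegral A (g • y) → ∀ i, ∃ c : A, algebraMap A K c =
      (minpoly K y).coeff i * algebraMap A K g ^ ((minpoly K y).natDegree - i) := by
    intro g hg hgy i
    have hg' : algebraMap A K g ≠ 0 := by simpa using hg
    have h1 := minpoly.isIntegrallyClosed_eq_field_fractions' K hgy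
    rw [← algebraMap_smul K g y, IsIntegrallyClosed.minpoly_smul hg' hy] at h1
    refine ⟨(minpoly A (g • y)).coeff i, ?_⟩
    rw [← Polynomial.coeff_scaleRoots, h1]
    simp
  have hl : minpoly K y ∈ Polynomial.lifts (algebraMap A K) := by
    rw [Polynomial.lifts_iff_coeff_lifts]
    intro i
    obtain ⟨a, b, hab, hc⟩ := IsFractionRing.exists_reduced_fraction (A := A) ((minpoly K y).coeff i)
    have hb : (b : A) ≠ 0 := nonZeroDivisors.ne_zero b.2
    by_cases hu : IsUnit (b : A)
    · obtain ⟨u, hu⟩ := hu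
      refine ⟨a * (u⁻¹ : Aˣ), ?_⟩
      rw [← hc, IsLocalization.eq_mk'_iff_mul_eq, ← hu, ← map_mul]
      simp
    · exfalso
      obtain ⟨p, hp, hpb⟩ := WfDvdMonoid.exists_irreducible_factor hu hb
      have hp := hp.prime
      obtain ⟨g, hg, hgy⟩ := h p hp
      have hg0 : g ≠ 0 := by rintro rfl; exact hg (dvd_zero _)
      obtain ⟨c, hcc⟩ := hco g hg0 hgy i
      have e1 : a * g ^ ((minpoly K y).natDegree - i) = b * c := by
        apply IsFractionRing.injective A K
        rw [map_mul, map_mul, hcc, ← hc, map_pow, ← mul_assoc, IsLocalization.mk'_spec']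
      have : p ∣ a * g ^ ((minpoly K y).natDegree - i) := by
        rw [e1]; exact hpb.mul_right c
      rcases hp.dvd_or_dvd this with h2 | h2
      · exact hp.not_isUnit (hab h2 hpb)
      · exact hg (hp.dvd_of_dvd_pow h2)
  obtain ⟨Q, hQ, -, hQm⟩ := Polynomial.lifts_and_degree_eq_and_monic hl (minpoly.monic hy)
  refine ⟨Q, hQm, ?_⟩
  have := minpoly.aeval K y
  rw [← hQ, Polynomial.aeval_map_algebraMap] at this
  exact this

lemma trdeg_of_int {k A : Type} [Field k] [CommRing A] [IsDomain A] [Algebra k A] {s : ℕ}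
    (g : MvPolynomial (Fin s) k →ₐ[k] A) (hg : Function.Injective g) (hi : g.IsIntegral) :
    Algebra.trdeg k A = s := by
  let _ : Algebra (MvPolynomial (Fin s) k) A := g.toRingHom.toAlgebra
  have : IsScalarTower k (MvPolynomial (Fin s) k) A := IsScalarTower.of_algebraMap_eq fun r => by
    exact (g.commutes r).symm
  have : Algebra.IsIntegral (MvPolynomial (Fin s) k) A := ⟨hi⟩
  have : FaithfulSMul (MvPolynomial (Fin s) k) A := (faithfulSMul_iff_algebraMap_injective _ _).2 hg
  have h := trdeg_add_eq k (MvPolynomial (Fin s) k) (A := A)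
  rw [MvPolynomial.trdeg_of_isDomain, trdeg_eq_zero_iff.2 inferInstance] at h
  rw [← h]; simp

lemma coeff_int {R : Type} [CommRing R] [Nontrivial R] (I : Ideal R) (n : ℕ) (x : R)
    (h : IsIntegral (reesAlgebra I) (Polynomial.monomial n x)) : IsIntegralOverIdeal (I ^ n) x := by
  obtain ⟨q, hq, h⟩ := h
  have hq' : (q * Polynomial.X).Monic := hq.mul Polynomial.monic_X
  have hd : 0 < (q * Polynomial.X).natDegree := by
    rw [Polynomial.natDegree_mul_X hq.ne_zero]; omega
  have h' : (q * Polynomial.X).eval₂ (algebraMap (reesAlgebra I) (Polynomial R))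
    (Polynomial.monomial n x) = 0 := by rw [Polynomial.eval₂_mul, h, zero_mul]
  generalize q * Polynomial.X = Q at hq' hd h'
  set N := Q.natDegree with hN
  refine ⟨N, hd, fun i => ((Q.coeff (N - i) : reesAlgebra I) : Polynomial R).coeff (n * i), ?_, ?_⟩
  · intro i _ _
    rw [← pow_mul]
    exact (Q.coeff (N - i)).2 _
  · have h2 := congrArg (fun f => Polynomial.coeff f (n * N)) h'
    simp only [Polynomial.eval₂_eq_sum_range, ← hN, Polynomial.finset_sum_coeff,
      Polynomial.coeff_zero] at h2
    rw [Finset.sum_range_succ, add_comm] at h2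
    have hc : Q.coeff N = 1 := hq'
    rw [hc] at h2
    simp only [map_one, one_mul, Polynomial.monomial_pow, Polynomial.coeff_monomial, if_true] at h2
    refine (congrArg₂ (· + ·) rfl ?_).trans h2
    refine Finset.sum_bij' (fun i _ => N - i) (fun i _ => N - i) ?_ ?_ ?_ ?_ ?_
    · intro i hi; simp at hi ⊢; omega
    · intro i hi; simp at hi ⊢; omega
    · intro i hi; simp at hi ⊢; omega
    · intro i hi; simp at hi ⊢; omega
    · intro i hi
      simp only [Finset.mem_Icc] at hi
      have : n * N = n * i + n * (N - i) := by rw [← mul_add]; congr 1; omega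
      rw [this, Polynomial.coeff_mul_monomial]
      rfl

lemma main_int {k R : Type} [Field k] [CommRing R] [IsDomain R] [Algebra k R]
    (hFG : Algebra.FiniteType k R) (m : Ideal R) (d : ℕ) (hd : ringKrullDim R = d)
    (I : Ideal R) (hI : I ≠ ⊥)
    (hspread : analyticSpread I m < (d : WithBot (WithTop ℕ))) (n : ℕ) (x : R)
    (hx : ∀ z ∈ m, z * x ∈ I ^ n) : IsIntegralOverIdeal (I ^ n) x := by
  have : IsNoetherianRing R := Algebra.FiniteType.isNoetherianRing k R
  have : Algebra.FiniteType k (reesAlgebra I) := Algebra.FiniteType.trans (S := R) hFG inferInstance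
  obtain ⟨s, g, hg, hgi⟩ := exists_integral_inj_algHom_of_fg k (reesAlgebra I)
  obtain ⟨r, f, hf, hfi⟩ := exists_integral_inj_algHom_of_fg k R
  have hrd : d ≤ r := by
    let _ : Algebra (MvPolynomial (Fin r) k) R := f.toRingHom.toAlgebra
    have : Algebra.IsIntegral (MvPolynomial (Fin r) k) R := ⟨hfi⟩
    have h := dim_le_of_int (A := MvPolynomial (Fin r) k) (B := R)
    rw [hd, MvPolynomial.ringKrullDim_of_isNoetherianRing] at h
    simp only [ringKrullDim_eq_zero_of_field, Nat.card_eq_fintype_card, Fintype.card_fin, zero_add] at h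
    exact_mod_cast h
  have hinjS : Function.Injective (algebraMap R (reesAlgebra I)) := by
    have : Function.Injective (algebraMap R (Polynomial R)) := Polynomial.C_injective
    rw [IsScalarTower.algebraMap_eq R (reesAlgebra I) (Polynomial R)] at this
    rw [RingHom.coe_comp] at this
    exact Function.Injective.of_comp this
  have hrs : r + 1 ≤ s := by
    have : FaithfulSMul R (reesAlgebra I) := (faithfulSMul_iff_algebraMap_injective _ _).2 hinjS
    have h := trdeg_add_eq k R (A := reesAlgebra I)
    rw [trdeg_of_int f hf hfi, trdeg_of_int g hg hgi] at h
    obtain ⟨a, ha, ha0⟩ := Submodule.exists_mem_ne_zero_of_ne_bot hI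
    let T : reesAlgebra I := ⟨Polynomial.monomial 1 a, reesAlgebra.monomial_mem.2 (by simpa using ha)⟩
    have hinj : Function.Injective (Polynomial.aeval (R := R) T) := by
      have : Function.Injective (Polynomial.aeval (R := R) (Polynomial.monomial 1 a : Polynomial R)) := by
        rw [injective_iff_map_eq_zero]
        intro p hp
        ext i
        have h2 := congrArg (fun f => Polynomial.coeff f i) hp
        have h3 : (Polynomial.monomial 1 a : Polynomial R) = Polynomial.C a * Polynomial.X := by
          rw [Polynomial.C_mul_X_eq_monomial]
        change Polynomial.coeff (p.comp (Polynomial.monomial 1 a)) i = _ at h2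
        rw [h3, Polynomial.comp_C_mul_X_coeff] at h2
        simpa [ha0] using h2
      have h4 : ⇑(Polynomial.aeval (R := R) (Polynomial.monomial 1 a : Polynomial R)) =
          (reesAlgebra I).val ∘ (Polynomial.aeval (R := R) T) := by
        ext1 p
        simp only [Function.comp]
        rw [← Polynomial.aeval_algHom_apply]
        rfl
      rw [h4] at this
      exact Function.Injective.of_comp this
    have h1 := trdeg_le_of_injective _ hinj
    rw [Polynomial.trdeg_of_isDomain] at h1
    have : ((r + 1 : ℕ) : Cardinal) ≤ s := by
      rw [← h]; push_cast; gcongr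
    exact_mod_cast this
  let A := MvPolynomial (Fin s) k
  let L := FractionRing (Polynomial R)
  let _ : Algebra A (reesAlgebra I) := g.toRingHom.toAlgebra
  have hAint : Algebra.IsIntegral A (reesAlgebra I) := ⟨hgi⟩
  let J : Ideal (reesAlgebra I) := Ideal.map (algebraMap R (reesAlgebra I)) m
  have hdim : ringKrullDim (A ⧸ J.comap (algebraMap A _)) < d := by
    have : Algebra.IsIntegral (A ⧸ J.comap (algebraMap A _)) (reesAlgebra I ⧸ J) := inferInstance
    refine lt_of_le_of_lt (dim_ge_of_int (B := reesAlgebra I ⧸ J) ?_) hspread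
    exact Ideal.algebraMap_quotient_injective
  have hprime : ∀ p : A, Prime p → ∃ q, ¬ p ∣ q ∧ g q ∈ J := by
    intro p hp
    by_contra! hcon
    have hle : J.comap (algebraMap A _) ≤ Ideal.span {p} := by
      intro q hq
      rw [Ideal.mem_span_singleton]
      by_contra hpq
      exact hcon q hpq hq
    have h1 := dim_quot_prime k s p hp
    have h2 : ringKrullDim (A ⧸ Ideal.span {p}) ≤ ringKrullDim (A ⧸ J.comap (algebraMap A _)) :=
      ringKrullDim_le_of_surjective _ (Ideal.Quotient.factor_surjective hle)
    have h3 := lt_of_le_of_lt h2 hdim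
    change _ ≤ ringKrullDim (A ⧸ Ideal.span {p}) + 1 at h1
    have h5 : ((d + 1 : ℕ) : WithBot ℕ∞) ≤ s := by exact_mod_cast (by omega : d + 1 ≤ s)
    have h6 := h5.trans h1
    generalize ringKrullDim (A ⧸ Ideal.span {p}) = D at h3 h6
    have h7 : D + 1 < d + 1 := by
      induction D with
      | bot => simp
      | coe D =>
        have h8 : D < (d : ℕ∞) := WithBot.coe_lt_coe.1 h3
        obtain ⟨e, rfl⟩ := ENat.ne_top_iff_exists.1 h8.ne_top
        have h9 : e < d := by exact_mod_cast h8
        exact_mod_cast (by omega : e + 1 < d + 1)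
    push_cast at h6
    exact absurd h6 (not_le_of_gt h7)
  let _ : Algebra A (Polynomial R) := ((algebraMap (reesAlgebra I) (Polynomial R)).comp g.toRingHom).toAlgebra
  have : IsScalarTower A (reesAlgebra I) (Polynomial R) := IsScalarTower.of_algebraMap_eq fun _ => rfl
  have hAinj : Function.Injective (algebraMap A (Polynomial R)) :=
    Function.Injective.comp (g := (Subtype.val : reesAlgebra I → Polynomial R)) Subtype.val_injective hg
  have : FaithfulSMul A (Polynomial R) := (faithfulSMul_iff_algebraMap_injective _ _).2 hAinj
  have : IsScalarTower A (Polynomial R) L := inferInstance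
  have : FaithfulSMul A L := (faithfulSMul_iff_algebraMap_injective _ _).2
    (by
      rw [IsScalarTower.algebraMap_eq A (Polynomial R) L]
      exact (IsFractionRing.injective (Polynomial R) L).comp hAinj)
  let _ : Algebra (FractionRing A) L := FractionRing.liftAlgebra A L
  have hJ : ∀ j ∈ J, (j : Polynomial R) * Polynomial.monomial n x ∈ reesAlgebra I := by
    intro j hj
    refine Submodule.span_induction ?_ ?_ ?_ ?_ hj
    · rintro _ ⟨z, hz, rfl⟩
      change Polynomial.C z * _ ∈ _
      rw [Polynomial.C_mul_monomial]
      exact reesAlgebra.monomial_mem.2 (hx z hz)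
    · simp
    · intro u v _ _ hu hv
      rw [Subalgebra.coe_add, add_mul]
      exact add_mem hu hv
    · intro u v _ hv
      rw [smul_eq_mul, Subalgebra.coe_mul, mul_assoc]
      exact mul_mem u.2 hv
  have hint : ∀ q : A, g q ∈ J →
      IsIntegral A (q • algebraMap (Polynomial R) L (Polynomial.monomial n x)) := by
    intro q hq
    have h1 : IsIntegral A (⟨_, hJ _ hq⟩ : reesAlgebra I) := hAint.isIntegral _
    have h2 := (h1.map (IsScalarTower.toAlgHom A (reesAlgebra I) (Polynomial R))).map
      (IsScalarTower.toAlgHom A (Polynomial R) L)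
    convert h2 using 1
    rw [Algebra.smul_def, IsScalarTower.algebraMap_apply A (Polynomial R) L, ← map_mul]
    rfl
  have hfin : IsIntegral A (algebraMap (Polynomial R) L (Polynomial.monomial n x)) := by
    refine key (K := FractionRing A) _ ?_ ?_
    · obtain ⟨q, hq, hqJ⟩ := hprime (MvPolynomial.X ⟨0, by omega⟩) (MvPolynomial.X_prime)
      exact ⟨q, by rintro rfl; exact hq (dvd_zero _), hint q hqJ⟩
    · intro p hp
      obtain ⟨q, hq, hqJ⟩ := hprime p hp
      exact ⟨q, hq, hint q hqJ⟩
  have hfin2 : IsIntegral A (Polynomial.monomial n x : Polynomial R) :=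
    (isIntegral_algebraMap_iff (IsFractionRing.injective (Polynomial R) L)).1 hfin
  exact coeff_int I n x hfin2.tower_top

theorem statement12 (k : Type) [Field k]
    (R : Type) [CommRing R] [IsDomain R] [Algebra k R]
    (𝒜 : ℕ → Submodule k R) [GradedAlgebra 𝒜]
    -- `R` is a quotient of a polynomial ring by a homogeneous prime ideal
    (hFG : Algebra.FiniteType k R)
    (hstd : Algebra.adjoin k (𝒜 1 : Set R) = ⊤)
    (m : Ideal R) (hm : m = (HomogeneousIdeal.irrelevant 𝒜).toIdeal)
    (d : ℕ) (hd : ringKrullDim R = d)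
    -- `depth (R_m) ≥ 2`
    (hdepth : ∃ a b : R, a ∈ m ∧ b ∈ m ∧ RingTheory.Sequence.IsRegular R [a, b])
    -- a normal homogeneous ideal with analytic spread `< d`
    (I : Ideal R) (hI : I.IsHomogeneous 𝒜)
    (hnormal : ∀ n : ℕ, 1 ≤ n → ∀ x : R, IsIntegralOverIdeal (I ^ n) x → x ∈ I ^ n)
    (hspread : analyticSpread I m < (d : WithBot (WithTop ℕ))) :
    (∃ N : ℕ, ∀ n : ℕ, N ≤ n → H0 (M := R ⧸ I ^ n) m = ⊥) ∧
    Tendsto (fun n : ℕ =>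
        (Module.finrank k (H0 (M := R ⧸ I ^ n) m) : ℝ) / (n : ℝ) ^ d)
      atTop (nhds 0) := by
  have key2 : ∀ n x, (∀ z ∈ m, z * x ∈ I ^ n) → x ∈ I ^ n := by
    intro n x hx
    rcases Nat.eq_zero_or_pos n with rfl | hn
    · simp
    by_cases hI0 : I = ⊥
    · obtain ⟨a, b, ha, hb, hr⟩ := hdepth
      have ha0 : a ≠ 0 := by
        have h1 := ((RingTheory.Sequence.isWeaklyRegular_cons_iff R a [b]).1 hr.1).1
        rintro rfl
        have := @h1 1 0 (by simp)
        exact one_ne_zero this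
      have h2 := hx a ha
      subst hI0
      rw [Ideal.bot_pow (by omega), Ideal.mem_bot] at h2 ⊢
      exact (mul_eq_zero.1 h2).resolve_left ha0
    · exact hnormal n hn x (main_int hFG m d hd I hI0 hspread n x hx)
  have key3 : ∀ n s x, (∀ z ∈ m ^ s, z * x ∈ I ^ n) → x ∈ I ^ n := by
    intro n s
    induction s with
    | zero =>
      intro x hx
      simpa using hx 1 (by simp)
    | succ s ih =>
      intro x hx
      refine key2 n x fun z hz => ih _ fun w hw => ?_
      rw [← mul_assoc]
      exact hx _ (by rw [pow_succ]; exact Ideal.mul_mem_mul hw hz)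
  have hbot : ∀ n, H0 (M := R ⧸ I ^ n) m = ⊥ := by
    intro n
    refine iSup_eq_bot.2 fun s => ?_
    rw [eq_bot_iff]
    intro y hy
    obtain ⟨x, rfl⟩ := Ideal.Quotient.mk_surjective y
    rw [Submodule.mem_torsionBySet_iff] at hy
    rw [Submodule.mem_bot, Ideal.Quotient.eq_zero_iff_mem]
    refine key3 n s x fun z hz => ?_
    have := hy ⟨z, hz⟩
    rw [← Ideal.Quotient.eq_zero_iff_mem, map_mul]
    exact this
  refine ⟨⟨0, fun n _ => hbot n⟩, ?_⟩
  have : (fun n : ℕ => (Module.finrank k (H0 (M := R ⧸ I ^ n) m) : ℝ) / (n : ℝ) ^ d) =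
      fun _ => 0 := by
    funext n
    have : Subsingleton (H0 (M := R ⧸ I ^ n) m) := by
      rw [hbot n]; infer_instance
    rw [Module.finrank_zero_of_subsingleton]
    simp
  rw [this]
  exact tendsto_const_nhds
end

section
/- Let k be a field, R a graded domain over k which is the quotient of a polynomial ring by a homogeneous prime ideal, d = dim R, and let I ⊆ R be a homogeneous ideal of height ≥ 1 generated by homogeneous elements of degrees less than an integer e. Define τ(n) = Σ_{m=0}^{en} dim_k (I^n)_m. Then τ(n) agrees, for all sufficiently large n, with a polynomial of degree ≤ d in n with rational coefficients; consequently lim_{n→∞} τ(n)/n^d exists and is a rational number. Moreover τ(n) equals dim_k S_{(en,n)}, where S = R[s][I·R[s] t] is the Rees algebra of the ideal I·R[s] over the polynomial ring R[s], bigraded with deg x_i = (1,0), deg s = (1,0), and deg F_j t = (d_j, 1) for homogeneous generators F_j of I of degree d_j. -/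
/-!
STATEMENT 14: Let `k` be a field, `R` a graded domain over `k` which is the quotient of a
polynomial ring by a homogeneous prime ideal, `d = dim R`, and let `I ⊆ R` be a homogeneous
ideal of height `≥ 1` generated by homogeneous elements of degrees less than an integer `e`.
Define `τ(n) = Σ_{m=0}^{en} dim_k (Iⁿ)_m`.  Then `τ(n)` agrees, for all sufficiently large
`n`, with a polynomial of degree `≤ d` in `n` with rational coefficients; consequently
`lim_{n→∞} τ(n)/n^d` exists and is a rational number.  Moreover `τ(n) = dim_k S_{(en,n)}`,
where `S = R[s][I·R[s]·t]` is the Rees algebra of `I·R[s]` over `R[s]`, bigraded with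
`deg x = (1,0)` for `x ∈ 𝒜 1`, `deg s = (1,0)` and `deg (F t) = (deg F, 1)` for homogeneous
`F ∈ I`.

`R` is modelled as a finitely generated standard ℕ-graded `k`-algebra domain.  The
bidegree-`(en,n)` piece of `S` inside `R[s][t]` consists of the elements
`(Σ_i f_i s^i) tⁿ` with `f_i ∈ (Iⁿ)_{en−i}`; this is the submodule `reesPiece` below.
-/

open Filter Polynomial

/-- Height of an ideal: the infimum of the heights of the primes containing it. -/
noncomputable def idealHeight {R : Type*} [CommRing R] (I : Ideal R) : ℕ∞ :=
  ⨅ (p : PrimeSpectrum R) (_ : I ≤ p.asIdeal), Order.height p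

/-- The degree-`i` graded piece of an ideal `N` of a graded algebra, as a `k`-submodule. -/
noncomputable def piece {k R : Type*} [Field k] [CommRing R] [Algebra k R]
    (𝒜 : ℕ → Submodule k R) (N : Ideal R) (i : ℕ) : Submodule k R :=
  (Submodule.restrictScalars k (N : Submodule R R)) ⊓ 𝒜 i

/-- The bidegree-`(en, n)` piece `S_{(en,n)} = ⊕_{i≤en} (Iⁿ)_{en-i}·sⁱ·tⁿ` of the bigraded
Rees algebra `S = R[s][I·R[s]·t] ⊆ R[s][t]` (the inner polynomial variable is `s`, the outer
one is `t`). -/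
noncomputable def reesPiece {k R : Type*} [Field k] [CommRing R] [Algebra k R]
    (𝒜 : ℕ → Submodule k R) (I : Ideal R) (e n : ℕ) :
    Submodule k (Polynomial (Polynomial R)) where
  carrier := {x | ∃ p : Polynomial R,
    x = Polynomial.monomial n p ∧
    ∀ i : ℕ, p.coeff i ∈
      ((Submodule.restrictScalars k ((I ^ n : Ideal R) : Submodule R R)) ⊓
        (if i ≤ e * n then 𝒜 (e * n - i) else ⊥))}
  zero_mem' := ⟨0, by simp, fun i => by simp⟩
  add_mem' := by
    rintro x y ⟨p, rfl, hp⟩ ⟨q, rfl, hq⟩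
    refine ⟨p + q, ?_, fun i => by
      rw [Polynomial.coeff_add]; exact add_mem (hp i) (hq i)⟩
    rw [map_add]
  smul_mem' := by
    rintro c x ⟨p, rfl, hp⟩
    refine ⟨c • p, ?_, fun i => by
      rw [Polynomial.coeff_smul]; exact Submodule.smul_mem _ c (hp i)⟩
    rw [Polynomial.smul_monomial]


/-- Eventually polynomial functions. -/
def EvPoly (f : ℕ → ℚ) : Prop := ∃ P : Polynomial ℚ, ∃ N : ℕ, ∀ n, N ≤ n → f n = P.eval (n : ℚ)

theorem EvPoly.add {f g : ℕ → ℚ} (hf : EvPoly f) (hg : EvPoly g) :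
    EvPoly (fun n => f n + g n) := by
  obtain ⟨P, N, h⟩ := hf
  obtain ⟨Q, M, h'⟩ := hg
  refine ⟨P + Q, max N M, fun n hn => ?_⟩
  simp only [h n (le_trans (le_max_left _ _) hn), h' n (le_trans (le_max_right _ _) hn), eval_add]

theorem EvPoly.const (c : ℚ) : EvPoly (fun _ => c) := ⟨C c, 0, by simp⟩

theorem EvPoly.congr {f g : ℕ → ℚ} (hf : EvPoly f) (M : ℕ) (h : ∀ n, M ≤ n → g n = f n) :
    EvPoly g := by
  obtain ⟨P, N, h'⟩ := hf
  refine ⟨P, max N M, fun n hn => ?_⟩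
  rw [h n (le_trans (le_max_right _ _) hn), h' n (le_trans (le_max_left _ _) hn)]

theorem EvPoly.sum {ι : Type*} (s : Finset ι) {f : ι → ℕ → ℚ} (hf : ∀ i ∈ s, EvPoly (f i)) :
    EvPoly (fun n => ∑ i ∈ s, f i n) := by
  classical
  induction s using Finset.induction_on with
  | empty => simpa using EvPoly.const 0
  | insert a s ha ih =>
    simp only [Finset.sum_insert ha]
    exact (hf a (by simp)).add (ih fun i hi => hf i (by simp [hi]))

/-- shifting -/
theorem EvPoly.shift_add {f : ℕ → ℚ} (hf : EvPoly f) (c : ℕ) : EvPoly (fun n => f (n + c)) := by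
  obtain ⟨P, N, h⟩ := hf
  refine ⟨P.comp (X + C (c : ℚ)), N, fun n hn => ?_⟩
  have := h (n + c) (by omega)
  simp [this]

theorem EvPoly.shift_sub {f : ℕ → ℚ} (hf : EvPoly f) (c : ℕ) : EvPoly (fun n => f (n - c)) := by
  obtain ⟨P, N, h⟩ := hf
  refine ⟨P.comp (X - C (c : ℚ)), N + c, fun n hn => ?_⟩
  have := h (n - c) (by omega)
  rw [Nat.cast_sub (by omega)] at this
  simp [this]

theorem EvPoly.sum_poly (P : Polynomial ℚ) :
    ∃ Q : Polynomial ℚ, ∀ n : ℕ, ∑ m ∈ Finset.range n, P.eval (m : ℚ) = Q.eval (n : ℚ) := by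
  induction P using Polynomial.induction_on' with
  | add p q hp hq =>
    obtain ⟨Q, h⟩ := hp
    obtain ⟨Q', h'⟩ := hq
    exact ⟨Q + Q', fun n => by simp [Finset.sum_add_distrib, h, h']⟩
  | monomial p a =>
    refine ⟨C a * ∑ i ∈ Finset.range (p + 1),
      C (_root_.bernoulli i * ((p + 1).choose i : ℚ) / (p + 1)) * X ^ (p + 1 - i), fun n => ?_⟩
    simp only [eval_monomial, ← Finset.mul_sum, sum_range_pow, eval_mul, eval_C, eval_finsetSum,
      eval_pow, eval_X]
    congr 1
    refine Finset.sum_congr rfl fun i _ => ?_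
    ring

theorem EvPoly.partial_sum {f : ℕ → ℚ} (hf : EvPoly f) :
    EvPoly (fun n => ∑ m ∈ Finset.range n, f m) := by
  obtain ⟨P, N, h⟩ := hf
  obtain ⟨Q, hQ⟩ := EvPoly.sum_poly P
  refine ⟨Q + C (∑ m ∈ Finset.range N, (f m - P.eval (m : ℚ))), N, fun n hn => ?_⟩
  rw [eval_add, ← hQ, eval_C]
  obtain ⟨c, rfl⟩ := Nat.exists_eq_add_of_le hn
  have : ∑ m ∈ Finset.range (N + c), (f m - P.eval (m : ℚ)) =
      ∑ m ∈ Finset.range N, (f m - P.eval (m : ℚ)) := by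
    rw [Finset.sum_range_add, add_eq_left]
    exact Finset.sum_eq_zero fun m _ => by rw [h _ (by omega), sub_self]
  rw [← this, Finset.sum_sub_distrib]
  ring

open Classical in
/-- Number of points of `L` of total degree `n`. -/
noncomputable def cntDeg (r : ℕ) (L : Set (Fin r → ℕ)) (n : ℕ) : ℕ :=
  ((Finset.Nat.antidiagonalTuple r n).filter (· ∈ L)).card

theorem cntDeg_succ (r : ℕ) (L : Set (Fin (r + 1) → ℕ)) (n : ℕ) :
    cntDeg (r + 1) L n = ∑ j ∈ Finset.range (n + 1),
      cntDeg r {a | (Fin.cons j a : Fin (r + 1) → ℕ) ∈ L} (n - j) := by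
  classical
  unfold cntDeg
  rw [Finset.card_eq_sum_card_fiberwise (f := fun a => a 0) (t := Finset.range (n + 1))]
  · refine Finset.sum_congr rfl fun j hj => ?_
    rw [Finset.mem_range] at hj
    symm
    refine Finset.card_bij (fun a _ => (Fin.cons j a : Fin (r + 1) → ℕ)) ?_ ?_ ?_
    · intro a ha
      simp only [Finset.mem_filter, Finset.Nat.mem_antidiagonalTuple, Set.mem_ofPred_eq] at ha ⊢
      refine ⟨⟨?_, ha.2⟩, by simp⟩
      rw [Fin.sum_univ_succ]
      simp [ha.1]; omega
    · intro a _ b _ h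
      exact (Fin.cons_right_injective (α := fun _ => ℕ) j) h
    · intro b hb
      simp only [Finset.mem_filter, Finset.Nat.mem_antidiagonalTuple] at hb
      obtain ⟨⟨h1, h2⟩, h3⟩ := hb
      have e : (Fin.cons j (Fin.tail b) : Fin (r + 1) → ℕ) = b := by
        rw [← h3]; exact Fin.cons_self_tail b
      refine ⟨Fin.tail b, ?_, e⟩
      simp only [Finset.mem_filter, Finset.Nat.mem_antidiagonalTuple, Set.mem_ofPred_eq]
      refine ⟨?_, by rw [e]; exact h2⟩
      rw [Fin.sum_univ_succ, h3] at h1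
      simp only [Fin.tail]; omega
  · intro a ha
    simp only [Finset.coe_filter, Finset.Nat.mem_antidiagonalTuple, Set.mem_ofPred_eq] at ha
    simp only [Finset.coe_range, Set.mem_Iio]
    have := Finset.single_le_sum (f := a) (fun i _ => Nat.zero_le _) (Finset.mem_univ 0)
    omega

theorem upper_stab {α : Type*} [Preorder α] [WellQuasiOrderedLE α] (U : ℕ → Set α)
    (hU : ∀ j, IsUpperSet (U j)) (hm : Monotone U) : ∃ j0, ∀ j, j0 ≤ j → U j = U j0 := by
  by_contra! h
  have h2 : ∀ j0, ∃ j, j0 < j ∧ ∃ a, a ∈ U j ∧ a ∉ U j0 := by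
    intro j0
    obtain ⟨j, hj, hne⟩ := h j0
    have hlt : U j0 < U j := lt_of_le_of_ne (hm hj) (Ne.symm hne)
    obtain ⟨a, ha, ha'⟩ := Set.exists_of_ssubset hlt
    refine ⟨j, lt_of_le_of_ne hj ?_, a, ha, ha'⟩
    rintro rfl; exact hne rfl
  choose g hg a ha ha' using h2
  let s : ℕ → ℕ := fun n => g^[n] 0
  have hs : ∀ n, s (n + 1) = g (s n) := fun n => Function.iterate_succ_apply' g n 0
  have hsm : StrictMono s := strictMono_nat_of_lt_succ fun n => by rw [hs]; exact hg _
  obtain ⟨m, n, hmn, hle⟩ := wellQuasiOrdered_le (fun n => a (s n))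
  refine ha' (s n) (hU _ hle (hm (hsm.monotone (show m + 1 ≤ n from hmn)) ?_))
  rw [hs]; exact ha _

theorem cntDeg_evPoly (r : ℕ) (L : Set (Fin r → ℕ)) (hL : IsLowerSet L) :
    EvPoly (fun n => (cntDeg r L n : ℚ)) := by
  induction r with
  | zero =>
    refine (EvPoly.const 0).congr 1 fun n hn => ?_
    obtain ⟨m, rfl⟩ := Nat.exists_eq_add_of_le' hn
    simp [cntDeg]
  | succ r ih =>
    let S : ℕ → Set (Fin r → ℕ) := fun j => {a | (Fin.cons j a : Fin (r + 1) → ℕ) ∈ L}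
    have hS : ∀ j, IsLowerSet (S j) := by
      intro j a b hab ha
      refine hL ?_ ha
      exact Fin.cons_le_cons.2 ⟨le_rfl, hab⟩
    obtain ⟨j0, hj0⟩ := upper_stab (fun j => (S j)ᶜ) (fun j => (hS j).compl) (by
      intro i j hij
      refine Set.compl_subset_compl.2 ?_
      intro a ha
      exact hL (Fin.cons_le_cons.2 ⟨hij, le_rfl⟩) ha)
    have hj1 : ∀ j, j0 ≤ j → S j = S j0 := fun j hj => compl_injective (hj0 j hj)
    have key : ∀ n, j0 ≤ n → (cntDeg (r + 1) L n : ℚ) =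
        ∑ j ∈ Finset.range j0, (cntDeg r (S j) (n - j) : ℚ) +
          ∑ m ∈ Finset.range ((n - j0) + 1), (cntDeg r (S j0) m : ℚ) := by
      intro n hn
      rw [cntDeg_succ]
      obtain ⟨c, rfl⟩ := Nat.exists_eq_add_of_le hn
      rw [add_assoc, Finset.sum_range_add]
      push_cast
      congr 1
      rw [← Finset.sum_range_reflect]
      rw [show j0 + c - j0 = c by omega]
      refine Finset.sum_congr rfl fun i hi => ?_
      rw [Finset.mem_range] at hi
      have := hj1 (j0 + (c + 1 - 1 - i)) (by omega)
      simp only [S] at this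
      rw [this]
      congr 2
      omega
    refine EvPoly.congr ?_ j0 key
    refine EvPoly.add (EvPoly.sum _ fun j _ => (ih _ (hS j)).shift_sub j) ?_
    exact ((ih _ (hS j0)).partial_sum.shift_add 1).shift_sub j0
open Classical in
theorem greedy_basis {k M ι : Type*} [Field k] [AddCommGroup M] [Module k M] [LinearOrder ι]
    (v : ι → M) (s : Finset ι) :
    Module.finrank k (Submodule.span k (v '' (s : Set ι))) =
      (s.filter (fun a => v a ∉ Submodule.span k (v '' {b | b ∈ s ∧ b < a}))).card := by
  have key : LinearIndepOn k v
        ((s.filter (fun a => v a ∉ Submodule.span k (v '' {b | b ∈ s ∧ b < a})) : Finset ι) : Set ι) ∧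
      Submodule.span k (v '' (s : Set ι)) ≤ Submodule.span k (v ''
        ((s.filter (fun a => v a ∉ Submodule.span k (v '' {b | b ∈ s ∧ b < a})) : Finset ι) :
          Set ι)) := by
    induction s using Finset.induction_on_max with
    | empty => simp
    | insert a s hs ih =>
      have has : a ∉ s := fun h => lt_irrefl _ (hs a h)
      have h1 : ∀ c ∈ s, {b | b ∈ insert a s ∧ b < c} = {b | b ∈ s ∧ b < c} := by
        intro c hc
        ext b
        simp only [Finset.mem_insert, Set.mem_ofPred_eq]
        constructor
        · rintro ⟨rfl | h, h'⟩
          · exact absurd (h'.trans (hs c hc)) (lt_irrefl _)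
          · exact ⟨h, h'⟩
        · rintro ⟨h, h'⟩; exact ⟨Or.inr h, h'⟩
      have h2 : {b | b ∈ insert a s ∧ b < a} = (s : Set ι) := by
        ext b
        simp only [Finset.mem_insert, Set.mem_ofPred_eq, Finset.mem_coe]
        constructor
        · rintro ⟨rfl | h, h'⟩
          · exact absurd h' (lt_irrefl _)
          · exact h
        · intro h; exact ⟨Or.inr h, hs b h⟩
      have h3 : s.filter (fun c => v c ∉ Submodule.span k (v '' {b | b ∈ insert a s ∧ b < c})) =
          s.filter (fun c => v c ∉ Submodule.span k (v '' {b | b ∈ s ∧ b < c})) :=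
        Finset.filter_congr fun c hc => by rw [h1 c hc]
      have heq : Submodule.span k (v '' (s : Set ι)) = Submodule.span k (v ''
        ((s.filter (fun a => v a ∉ Submodule.span k (v '' {b | b ∈ s ∧ b < a})) : Finset ι) :
          Set ι)) :=
        le_antisymm ih.2 (Submodule.span_mono (Set.image_mono (by
          intro x hx; exact (Finset.mem_filter.1 hx).1)))
      rw [Finset.filter_insert, h3, h2]
      by_cases h : v a ∈ Submodule.span k (v '' (s : Set ι))
      · rw [if_neg (not_not_intro h)]
        refine ⟨ih.1, ?_⟩
        rw [Finset.coe_insert, Set.image_insert_eq, Submodule.span_insert]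
        refine sup_le ?_ ih.2
        rw [Submodule.span_singleton_le_iff_mem, ← heq]
        exact h
      · rw [if_pos h, Finset.coe_insert, Finset.coe_insert, Set.image_insert_eq,
          Set.image_insert_eq]
        refine ⟨ih.1.insert (by rw [← heq]; exact h), ?_⟩
        rw [Submodule.span_insert, Submodule.span_insert]
        exact sup_le_sup le_rfl ih.2
  have heq := le_antisymm key.2 (Submodule.span_mono (Set.image_mono (by
          intro x hx; exact (Finset.mem_filter.1 hx).1)))
  rw [heq]
  have := finrank_span_set_eq_card (R := k) key.1.id_image
  rw [this, ← Set.ncard_eq_toFinset_card', Set.ncard_image_of_injOn key.1.injOn,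
    Set.ncard_coe_finset]

open Pointwise in
theorem range_pow_eq {k R : Type*} [Field k] [CommRing R] [Algebra k R] {r : ℕ} (v : Fin r → R)
    (n : ℕ) : (Set.range v) ^ n =
      (fun a : Fin r → ℕ => ∏ i, v i ^ a i) '' {a | ∑ i, a i = n} := by
  induction n with
  | zero =>
    ext x
    simp only [pow_zero, Set.mem_one, Set.mem_image, Set.mem_ofPred_eq]
    constructor
    · rintro rfl; exact ⟨0, by simp, by simp⟩
    · rintro ⟨a, ha, rfl⟩
      simp only [Finset.sum_eq_zero_iff, Finset.mem_univ, true_imp_iff] at ha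
      simp [ha]
  | succ n ih =>
    rw [pow_succ, ih]
    ext x
    simp only [Set.mem_mul, Set.mem_image, Set.mem_ofPred_eq, Set.mem_range]
    constructor
    · rintro ⟨_, ⟨a, ha, rfl⟩, _, ⟨j, rfl⟩, rfl⟩
      refine ⟨a + Pi.single j 1, by simp [Finset.sum_add_distrib, ha], ?_⟩
      simp only [Pi.add_apply, pow_add, Finset.prod_mul_distrib]
      congr 1
      rw [Finset.prod_eq_single j] <;> simp +contextual [Pi.single_apply]
    · rintro ⟨a, ha, rfl⟩
      obtain ⟨j, -, hj⟩ := Finset.exists_ne_zero_of_sum_ne_zero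
        (s := Finset.univ) (f := a) (by rw [ha]; omega)
      have e : a = (a - Pi.single j 1) + Pi.single j 1 := by
        ext i
        simp only [Pi.add_apply, Pi.sub_apply, Pi.single_apply]
        split_ifs with h
        · subst h; omega
        · omega
      refine ⟨_, ⟨a - Pi.single j 1, ?_, rfl⟩, _, ⟨j, rfl⟩, ?_⟩
      · rw [e] at ha
        simp only [Pi.add_apply, Finset.sum_add_distrib] at ha
        simp at ha
        simpa using ha
      · conv_rhs => rw [e]
        simp only [Pi.add_apply, pow_add, Finset.prod_mul_distrib]
        congr 1
        symm
        rw [Finset.prod_eq_single j] <;> simp +contextual [Pi.single_apply]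

theorem hilbert_pow {k R : Type*} [Field k] [CommRing R] [Algebra k R] (V : Submodule k R)
    (hV : V.FG) : EvPoly (fun n => (Module.finrank k (V ^ n : Submodule k R) : ℚ)) := by
  classical
  obtain ⟨r, v, rfl⟩ := Submodule.fg_iff_exists_fin_generating_family.1 hV
  let μ : Lex (Fin r → ℕ) → R := fun a => ∏ i, v i ^ (ofLex a) i
  let deg : (Fin r → ℕ) → ℕ := fun a => ∑ i, a i
  obtain ⟨L, hLdef⟩ : ∃ L : Set (Fin r → ℕ), ∀ a, a ∈ L ↔ μ (toLex a) ∉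
    Submodule.span k (μ '' {b | deg (ofLex b) = deg a ∧ b < toLex a}) :=
    ⟨{a | μ (toLex a) ∉
      Submodule.span k (μ '' {b | deg (ofLex b) = deg a ∧ b < toLex a})}, fun _ => Iff.rfl⟩
  have hμ : ∀ a b, μ (a + b) = μ a * μ b := by
    intro a b
    simp only [μ, ← Finset.prod_mul_distrib, ← pow_add]
    rfl
  have hL : IsLowerSet L := by
    intro a b hba ha
    rw [hLdef] at ha ⊢
    intro hb
    refine ha ?_
    obtain ⟨c, rfl⟩ := exists_add_of_le hba
    change μ (toLex b + toLex c) ∈ _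
    rw [hμ, mul_comm]
    have := Submodule.mem_map_of_mem (f := LinearMap.mulLeft k (μ (toLex c))) hb
    rw [Submodule.map_span] at this
    refine Submodule.span_mono ?_ this
    rintro _ ⟨_, ⟨d, ⟨hd, hlt⟩, rfl⟩, rfl⟩
    refine ⟨d + toLex c, ⟨?_, ?_⟩, ?_⟩
    · simp only [deg] at hd ⊢
      rw [show ∑ i, (b + c) i = ∑ i, b i + ∑ i, c i from Finset.sum_add_distrib, ← hd,
        ← Finset.sum_add_distrib]
      rfl
    · rw [toLex_add]
      exact add_lt_add_left hlt _
    · rw [hμ, mul_comm]; rfl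
  have := cntDeg_evPoly r L hL
  convert this using 3 with n
  let s : Finset (Lex (Fin r → ℕ)) := (Finset.Nat.antidiagonalTuple r n).map toLex.toEmbedding
  have hs : ∀ b, b ∈ s ↔ deg (ofLex b) = n := by
    intro b
    simp only [s, Finset.mem_map_equiv, Finset.Nat.mem_antidiagonalTuple]
    rfl
  have h1 : Submodule.span k (Set.range v) ^ n = Submodule.span k (μ '' (s : Set _)) := by
    rw [Submodule.span_pow, range_pow_eq (k := k)]
    congr 1
    ext x
    constructor
    · rintro ⟨a, ha, rfl⟩
      exact ⟨toLex a, (hs _).2 ha, rfl⟩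
    · rintro ⟨a, ha, rfl⟩
      exact ⟨ofLex a, (hs _).1 ha, rfl⟩
  rw [h1, greedy_basis]
  unfold cntDeg
  symm
  refine Finset.card_bij (fun a _ => toLex a) ?_ ?_ ?_
  · intro a ha
    rw [Finset.mem_filter, Finset.Nat.mem_antidiagonalTuple] at ha
    rw [Finset.mem_filter]
    refine ⟨(hs _).2 ha.1, ?_⟩
    have h2 := ha.2
    try rw [hLdef] at h2
    try rw [hLdef]
    intro h3
    refine h2 (Submodule.span_mono (Set.image_mono ?_) h3)
    rintro b ⟨hb, hb'⟩
    exact ⟨((hs b).1 hb).trans ha.1.symm, hb'⟩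
  · intro a _ b _ h; exact toLex_inj.1 h
  · intro a ha
    rw [Finset.mem_filter, hs] at ha
    refine ⟨ofLex a, ?_, rfl⟩
    rw [Finset.mem_filter, Finset.Nat.mem_antidiagonalTuple]
    refine ⟨ha.1, ?_⟩
    have h2 := ha.2
    try rw [hLdef] at h2
    try rw [hLdef]
    intro h3
    refine h2 (Submodule.span_mono (Set.image_mono ?_) h3)
    rintro b ⟨hb, hb'⟩
    exact ⟨(hs b).2 (hb.trans ha.1), hb'⟩
theorem ringKrullDim_le_of_injective_integral {A R : Type*} [CommRing A] [CommRing R] [Algebra A R]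
    [Algebra.IsIntegral A R] (hinj : Function.Injective (algebraMap A R)) :
    ringKrullDim A ≤ ringKrullDim R := by
  have key : ∀ l : LTSeries (PrimeSpectrum A), ∃ l' : LTSeries (PrimeSpectrum R),
      l'.length = l.length ∧ PrimeSpectrum.comap (algebraMap A R) l'.last = l.last := by
    intro l
    induction l using RelSeries.inductionOn' with
    | singleton p =>
      obtain ⟨Q, -, hQ, hQ'⟩ := Ideal.exists_ideal_over_prime_of_isIntegral p.asIdeal (⊥ : Ideal R)
        (by
          rw [← RingHom.ker_eq_comap_bot, (RingHom.injective_iff_ker_eq_bot _).1 hinj]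
          exact bot_le)
      refine ⟨RelSeries.singleton _ ⟨Q, hQ⟩, rfl, ?_⟩
      ext1
      simpa using hQ'
    | snoc l p hp ih =>
      obtain ⟨l', h1, h2⟩ := ih
      have hp' : l.last < p := hp
      have hle : l'.last.asIdeal.comap (algebraMap A R) ≤ p.asIdeal := by
        have : (PrimeSpectrum.comap (algebraMap A R) l'.last).asIdeal ≤ p.asIdeal := by
          rw [h2]; exact hp'.le
        exact this
      obtain ⟨Q, hQ0, hQ, hQ'⟩ :=
        Ideal.exists_ideal_over_prime_of_isIntegral p.asIdeal l'.last.asIdeal hle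
      refine ⟨l'.snoc ⟨Q, hQ⟩ ?_, congrArg (· + 1) h1, ?_⟩
      · have h3 : l'.last ≤ ⟨Q, hQ⟩ := hQ0
        refine lt_of_le_of_ne h3 fun h => ?_
        rw [h] at h2
        have : p = l.last := by
          rw [← h2]; ext1; exact hQ'.symm
        exact hp'.ne' this
      · simp only [RelSeries.last_snoc]
        ext1; exact hQ'
  refine iSup_le fun l => ?_
  obtain ⟨l', h1, -⟩ := key l
  rw [← h1]
  exact le_iSup (fun l : LTSeries (PrimeSpectrum R) => (l.length : WithBot ℕ∞)) l'

theorem finrank_mul_le' {k R : Type*} [Field k] [CommRing R] [Algebra k R] (M N : Submodule k R)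
    [FiniteDimensional k M] [FiniteDimensional k N] :
    Module.finrank k (M * N : Submodule k R) ≤ Module.finrank k M * Module.finrank k N := by
  rw [← Submodule.mulMap_range, ← Module.finrank_tensorProduct]
  exact LinearMap.finrank_range_le _

theorem finrank_restrictTotalDegree_le (k : Type*) [Field k] (s m : ℕ) :
    Module.finrank k (MvPolynomial.restrictTotalDegree (Fin s) k m) ≤ (m + 1) ^ s := by
  refine (Submodule.finrank_mono
    (MvPolynomial.restrictTotalDegree_le_restrictDegree (σ := Fin s) k m)).trans ?_
  have e := Module.finrank_eq_nat_card_basis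
    (MvPolynomial.basisRestrictSupport k { n : Fin s →₀ ℕ | ∀ i, n i ≤ m })
  change Module.finrank k (MvPolynomial.restrictSupport k { n : Fin s →₀ ℕ | ∀ i, n i ≤ m }) ≤ _
  rw [e]
  let φ : { n : Fin s →₀ ℕ | ∀ i, n i ≤ m } → (Fin s → Fin (m + 1)) :=
    fun n i => ⟨n.1 i, Nat.lt_succ_of_le (n.2 i)⟩
  have hφ : Function.Injective φ := by
    intro a b h
    ext i
    simpa [φ] using congrFun h i
  refine (Nat.card_le_card_of_injective φ hφ).trans ?_
  simp

theorem growth_bound {k R : Type*} [Field k] [CommRing R] [Nontrivial R] [Algebra k R]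
    (hFG : Algebra.FiniteType k R) (d : ℕ) (hd : ringKrullDim R = d) (V : Submodule k R)
    (hV : V.FG) : ∃ C : ℕ, ∀ n, Module.finrank k (V ^ n : Submodule k R) ≤ C * (n + 1) ^ d := by
  obtain ⟨s, g, hinj, hfin⟩ := exists_finite_inj_algHom_of_fg k R
  have hsd : s ≤ d := by
    algebraize [g.toRingHom]
    have : Module.Finite (MvPolynomial (Fin s) k) R := hfin
    have h1 : ringKrullDim (MvPolynomial (Fin s) k) ≤ ringKrullDim R :=
      ringKrullDim_le_of_injective_integral hinj
    rw [MvPolynomial.ringKrullDim_of_isNoetherianRing, ringKrullDim_eq_zero_of_field, hd] at h1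
    simpa using h1
  obtain ⟨T, hT⟩ : ∃ T : Finset R, ∀ W : Set R, (T : Set R) ⊆ W → 0 ∈ W →
      (∀ x ∈ W, ∀ y ∈ W, x + y ∈ W) → (∀ a, ∀ x ∈ W, g a * x ∈ W) → ∀ x, x ∈ W := by
    algebraize [g.toRingHom]
    have : Module.Finite (MvPolynomial (Fin s) k) R := hfin
    obtain ⟨T, hT⟩ := (Module.Finite.fg_top : (⊤ : Submodule (MvPolynomial (Fin s) k) R).FG)
    refine ⟨T, fun W h0 h1 h2 h3 x => ?_⟩
    have hx : x ∈ Submodule.span (MvPolynomial (Fin s) k) (T : Set R) := by rw [hT]; trivial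
    induction hx using Submodule.span_induction with
    | mem x hx => exact h0 hx
    | zero => exact h1
    | add x y _ _ hx hy => exact h2 x hx y hy
    | smul a x _ hx => rw [Algebra.smul_def]; exact h3 a x hx
  let A : ℕ → Submodule k R := fun m =>
    (MvPolynomial.restrictTotalDegree (Fin s) k m).map g.toLinearMap
  have hA : ∀ m c, A m * A c ≤ A (m + c) := by
    intro m c
    rw [Submodule.mul_le]
    rintro _ ⟨p, hp, rfl⟩ _ ⟨q, hq, rfl⟩
    refine ⟨p * q, ?_, by simp⟩
    simp only [SetLike.mem_coe, MvPolynomial.mem_restrictTotalDegree] at hp hq ⊢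
    exact (MvPolynomial.totalDegree_mul p q).trans (add_le_add hp hq)
  have hA1 : ∀ m, 1 ∈ A m := fun m => ⟨1, by simp [MvPolynomial.mem_restrictTotalDegree], by simp⟩
  have hAm : Monotone A := by
    intro m c hmc
    refine Submodule.map_mono ?_
    intro p hp
    rw [MvPolynomial.mem_restrictTotalDegree] at hp ⊢
    exact hp.trans hmc
  let E : Submodule k R := Submodule.span k T
  have hE : FiniteDimensional k E := FiniteDimensional.span_finset k T
  have hAf : ∀ m, FiniteDimensional k (A m) := fun m => by
    dsimp only [A]; infer_instance
  let F : ℕ → Submodule k R := fun m => A m * E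
  have hFm : Monotone F := fun m c h => mul_le_mul' (hAm h) le_rfl
  have hAF : ∀ m c, A c * F m ≤ F (m + c) := by
    intro m c
    simp only [F]
    rw [← mul_assoc, add_comm]
    exact mul_le_mul' (hA _ _) le_rfl
  have hF : ∀ x, ∃ m, x ∈ F m := by
    refine hT {x | ∃ m, x ∈ F m} ?_ ⟨0, zero_mem _⟩ ?_ ?_
    · intro x hx
      refine ⟨0, ?_⟩
      rw [← one_mul x]
      exact Submodule.mul_mem_mul (hA1 0) (Submodule.subset_span hx)
    · rintro x ⟨m, hm⟩ y ⟨c, hc⟩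
      exact ⟨max m c, add_mem (hFm (le_max_left _ _) hm) (hFm (le_max_right _ _) hc)⟩
    · rintro a x ⟨m, hm⟩
      refine ⟨m + a.totalDegree, hAF _ _ (Submodule.mul_mem_mul ⟨a, ?_, rfl⟩ hm)⟩
      simp [MvPolynomial.mem_restrictTotalDegree]
  have hfg : ∀ W : Submodule k R, W.FG → ∃ m, W ≤ F m := by
    rintro _ ⟨S, rfl⟩
    choose m hm using hF
    refine ⟨S.sup m, Submodule.span_le.2 fun x hx => hFm (Finset.le_sup hx) (hm x)⟩
  obtain ⟨c, hc⟩ := hfg (V * E) (hV.mul (Submodule.fg_span T.finite_toSet))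
  obtain ⟨c0, hc0⟩ := hF 1
  have hVF : ∀ n, V ^ n ≤ F (c0 + c * n) := by
    intro n
    have : ∀ n, V ^ n * F c0 ≤ F (c0 + c * n) := by
      intro n
      induction n with
      | zero => simp
      | succ n ih =>
        rw [pow_succ', mul_assoc]
        refine (mul_le_mul' le_rfl ih).trans ?_
        simp only [F] at hc ⊢
        rw [mul_left_comm]
        refine (mul_le_mul' le_rfl hc).trans ?_
        rw [← mul_assoc]
        refine mul_le_mul' ((hA _ _).trans (le_of_eq ?_)) le_rfl
        congr 1; ring
    intro x hx
    refine this n ?_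
    rw [← mul_one x]
    exact Submodule.mul_mem_mul hx hc0
  refine ⟨(c0 + c + 1) ^ d * Module.finrank k E, fun n => ?_⟩
  have : FiniteDimensional k (F (c0 + c * n)) := by
    have := (Submodule.fg_iff_finiteDimensional _).2 (hAf (c0 + c * n))
    exact (Submodule.fg_iff_finiteDimensional _).1
      (this.mul ((Submodule.fg_iff_finiteDimensional _).2 hE))
  refine (Submodule.finrank_mono (hVF n)).trans ((finrank_mul_le' _ _).trans ?_)
  rw [mul_right_comm, ← mul_pow]
  refine Nat.mul_le_mul_right _ ?_
  refine (Submodule.finrank_map_le _ _).trans ((finrank_restrictTotalDegree_le k s _).trans ?_)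
  refine (Nat.pow_le_pow_right (by omega) hsd).trans (Nat.pow_le_pow_left ?_ d)
  nlinarith

theorem natDegree_le_of_growth (P : Polynomial ℚ) (N d C : ℕ) (f : ℕ → ℕ)
    (hP : ∀ n : ℕ, N ≤ n → (f n : ℚ) = P.eval (n : ℚ)) (hf : ∀ n, f n ≤ C * (n + 1) ^ d) :
    P.natDegree ≤ d := by
  by_contra! hlt
  let Q : Polynomial ℚ := (X + 1) ^ d
  have hQ : Q.natDegree = d := by
    have : (X + 1 : Polynomial ℚ) = X + Polynomial.C 1 := by simp
    simp only [Q]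
    rw [this, natDegree_pow, natDegree_X_add_C, mul_one]
  have hQm : Q.Monic := by
    have : (X + 1 : Polynomial ℚ) = X + Polynomial.C 1 := by simp
    simp only [Q, this]
    exact (monic_X_add_C 1).pow d
  have hdeg : Q.degree < P.degree := degree_lt_degree (by omega)
  have h' := (abs_div_tendsto_atTop_atTop_of_degree_gt P Q hdeg hQm.ne_zero).comp
    (tendsto_natCast_atTop_atTop (R := ℚ))
  obtain ⟨n, hn, hn'⟩ := ((h'.eventually_gt_atTop (C : ℚ)).and (eventually_ge_atTop N)).exists
  simp only [Function.comp_apply, ← hP n hn'] at hn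
  have hpos : (0 : ℚ) < ((n : ℚ) + 1) ^ d := by positivity
  have e : eval (n : ℚ) Q = ((n : ℚ) + 1) ^ d := by simp [Q]
  rw [e, abs_of_nonneg (by positivity), lt_div_iff₀ hpos] at hn
  have := hf n
  have : (f n : ℚ) ≤ C * ((n : ℚ) + 1) ^ d := by exact_mod_cast this
  linarith

theorem limit_of_poly (P : Polynomial ℚ) (N d : ℕ) (f : ℕ → ℕ)
    (hP : ∀ n : ℕ, N ≤ n → (f n : ℚ) = P.eval (n : ℚ)) (hd : P.natDegree ≤ d) :
    Tendsto (fun n : ℕ => (f n : ℝ) / (n : ℝ) ^ d) atTop (nhds ((P.coeff d : ℚ) : ℝ)) := by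
  let P' : Polynomial ℝ := P.map (algebraMap ℚ ℝ)
  have hP' : P'.natDegree ≤ d := by simpa [P'] using hd
  have h1 : Tendsto (fun x : ℝ => P'.eval x / (X ^ d : Polynomial ℝ).eval x) atTop
      (nhds (P'.coeff d)) := by
    rcases hP'.lt_or_eq with h | h
    · rw [coeff_eq_zero_of_natDegree_lt h]
      refine div_tendsto_atTop_zero_of_degree_lt _ _ (degree_lt_degree (by simpa using h))
    · by_cases h0 : P' = 0
      · simp [h0]
      · have := div_tendsto_atTop_leadingCoeff_div_of_degree_eq P' (X ^ d)
          (by rw [degree_eq_natDegree h0, h]; simp)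
        simpa [leadingCoeff, h] using this
  have h2 := h1.comp (tendsto_natCast_atTop_atTop (R := ℝ))
  have h3 : P'.coeff d = ((P.coeff d : ℚ) : ℝ) := by simp [P']
  rw [h3] at h2
  refine h2.congr' ?_
  filter_upwards [eventually_ge_atTop N] with n hn
  simp only [Function.comp_apply, eval_pow, eval_X]
  congr 1
  have := hP n hn
  have h4 : ((f n : ℚ) : ℝ) = ((P.eval (n : ℚ) : ℚ) : ℝ) := by rw [this]
  rw [Rat.cast_natCast] at h4
  rw [h4]
  simp only [P', eval_map]
  have h5 := Polynomial.hom_eval₂ P (RingHom.id ℚ) (algebraMap ℚ ℝ) (n : ℚ)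
  simp only [RingHom.comp_id, map_natCast, eval₂_id] at h5
  rw [← h5]
  rfl

section graded
variable {k R : Type*} [Field k] [CommRing R] [Algebra k R]
  (𝒜 : ℕ → Submodule k R) [GradedAlgebra 𝒜]

open DirectSum in
theorem grade_eq_pow (hstd : Algebra.adjoin k (𝒜 1 : Set R) = ⊤) (a : ℕ) :
    𝒜 a = (𝒜 1) ^ a := by
  classical
  apply le_antisymm
  · have key : ∀ x : R, ∀ a, (decompose 𝒜 x a : R) ∈ (𝒜 1) ^ a := by
      intro x
      have hx : x ∈ Algebra.adjoin k (𝒜 1 : Set R) := hstd ▸ Algebra.mem_top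
      induction hx using Algebra.adjoin_induction with
      | mem x hx =>
        intro a
        by_cases h : 1 = a
        · subst h
          rw [decompose_of_mem_same 𝒜 hx, pow_one]
          exact hx
        · rw [decompose_of_mem_ne 𝒜 hx h]
          exact zero_mem _
      | algebraMap r =>
        intro a
        have hx : algebraMap k R r ∈ 𝒜 0 := SetLike.algebraMap_mem_graded 𝒜 r
        by_cases h : 0 = a
        · subst h
          rw [decompose_of_mem_same 𝒜 hx, pow_zero]
          exact Submodule.algebraMap_mem r
        · rw [decompose_of_mem_ne 𝒜 hx h]
          exact zero_mem _
      | add x y _ _ hx hy =>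
        intro a
        rw [decompose_add, DirectSum.add_apply, Submodule.coe_add]
        exact add_mem (hx a) (hy a)
      | mul x y _ _ hx hy =>
        intro a
        rw [decompose_mul, coe_mul_apply]
        refine sum_mem fun ij hij => ?_
        obtain ⟨_, h⟩ := Finset.mem_filter.1 hij
        rw [← h, pow_add]
        exact Submodule.mul_mem_mul (hx _) (hy _)
    intro x hx
    have := key x a
    rwa [decompose_of_mem_same 𝒜 hx] at this
  · induction a with
    | zero =>
      rw [pow_zero, Submodule.one_le]
      exact SetLike.GradedOne.one_mem
    | succ n ih =>
      rw [pow_succ, Submodule.mul_le]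
      intro x hx y hy
      exact SetLike.GradedMul.mul_mem (ih hx) hy

open DirectSum in
theorem grade_one_fg (hFG : Algebra.FiniteType k R)
    (hstd : Algebra.adjoin k (𝒜 1 : Set R) = ⊤) : (𝒜 1).FG := by
  classical
  obtain ⟨S, hS⟩ := hFG.out
  set W : Submodule k R := Submodule.span k (S.image fun x => (decompose 𝒜 x 1 : R)) with hW
  have key : ∀ x : R, (decompose 𝒜 x 1 : R) ∈ W := by
    intro x
    have hx : x ∈ Algebra.adjoin k (S : Set R) := hS ▸ Algebra.mem_top
    induction hx using Algebra.adjoin_induction with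
    | mem x hx =>
      apply Submodule.subset_span
      simp only [Finset.coe_image]
      exact ⟨x, hx, rfl⟩
    | algebraMap r =>
      have hx : algebraMap k R r ∈ 𝒜 0 := SetLike.algebraMap_mem_graded 𝒜 r
      rw [decompose_of_mem_ne 𝒜 hx (by norm_num)]
      exact zero_mem _
    | add x y _ _ hx hy =>
      rw [decompose_add, DirectSum.add_apply, Submodule.coe_add]
      exact add_mem hx hy
    | mul x y _ _ hx hy =>
      rw [decompose_mul, coe_mul_apply]
      refine sum_mem fun ij hij => ?_
      obtain ⟨_, h⟩ := Finset.mem_filter.1 hij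
      obtain ⟨i, j⟩ := ij
      have h0 : ∀ z ∈ 𝒜 0, ∃ c : k, algebraMap k R c = z := by
        intro z hz
        rw [grade_eq_pow 𝒜 hstd, pow_zero, Submodule.mem_one] at hz
        exact hz
      have hc : (i = 0 ∧ j = 1) ∨ (i = 1 ∧ j = 0) := by
        have : i + j = 1 := h
        omega
      rcases hc with ⟨rfl, rfl⟩ | ⟨rfl, rfl⟩
      · obtain ⟨c, hc⟩ := h0 _ (decompose 𝒜 x 0).2
        simp only
        rw [← hc, ← Algebra.smul_def]
        exact W.smul_mem c hy
      · obtain ⟨c, hc⟩ := h0 _ (decompose 𝒜 y 0).2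
        simp only
        rw [← hc, mul_comm, ← Algebra.smul_def]
        exact W.smul_mem c hx
  have hle : 𝒜 1 ≤ W := by
    intro x hx
    have := key x
    rwa [decompose_of_mem_same 𝒜 hx] at this
  have : W.FG := Submodule.fg_span (Finset.finite_toSet _)
  have hfin : FiniteDimensional k W := Module.Finite.iff_fg.2 this
  exact Module.Finite.iff_fg.1 (Submodule.finiteDimensional_of_le hle)

theorem piece_finite (hFG : Algebra.FiniteType k R)
    (hstd : Algebra.adjoin k (𝒜 1 : Set R) = ⊤) (J : Ideal R) (i : ℕ) :
    FiniteDimensional k (piece 𝒜 J i) := by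
  have h : (𝒜 i).FG := by
    rw [grade_eq_pow 𝒜 hstd]
    exact (grade_one_fg 𝒜 hFG hstd).pow i
  have : FiniteDimensional k (𝒜 i) := Module.Finite.iff_fg.2 h
  exact Submodule.finiteDimensional_of_le (inf_le_right : _ ≤ 𝒜 i)

theorem finrank_sup_pieces (J : Ideal R) (hfin : ∀ i, FiniteDimensional k (piece 𝒜 J i)) (N : ℕ) :
    FiniteDimensional k ((Finset.range N).sup (piece 𝒜 J) : Submodule k R) ∧
    Module.finrank k ((Finset.range N).sup (piece 𝒜 J) : Submodule k R) =
      ∑ i ∈ Finset.range N, Module.finrank k (piece 𝒜 J i) := by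
  classical
  induction N with
  | zero =>
    constructor
    · rw [Finset.range_zero, Finset.sup_empty]; infer_instance
    · rw [Finset.range_zero, Finset.sup_empty]; simp
  | succ N ih =>
    obtain ⟨ih1, ih2⟩ := ih
    have hN := hfin N
    rw [Finset.sum_range_succ, Finset.range_add_one, Finset.sup_insert]
    constructor
    · infer_instance
    · have h := Submodule.finrank_sup_add_finrank_inf_eq (piece 𝒜 J N)
        ((Finset.range N).sup (piece 𝒜 J))
      have hd : piece 𝒜 J N ⊓ ((Finset.range N).sup (piece 𝒜 J)) = ⊥ := by
        rw [eq_bot_iff]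
        rintro x ⟨hx1, hx2⟩
        have h3 : (Finset.range N).sup (piece 𝒜 J) ≤ LinearMap.ker (GradedAlgebra.proj 𝒜 N) := by
          apply Finset.sup_le
          intro i hi y hy
          rw [LinearMap.mem_ker, GradedAlgebra.proj_apply]
          exact DirectSum.decompose_of_mem_ne 𝒜 hy.2 (Finset.mem_range.1 hi).ne
        have h4 := h3 hx2
        rw [LinearMap.mem_ker, GradedAlgebra.proj_apply,
          DirectSum.decompose_of_mem_same 𝒜 hx1.2] at h4
        exact h4
      rw [hd, finrank_bot, add_zero, ih2] at h
      rw [h, add_comm]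

theorem sup_pieces_le (I : Ideal R) (e n : ℕ) :
    ((Finset.range (e + 1)).sup (piece 𝒜 I)) ^ n ≤
      (Finset.range (e * n + 1)).sup (piece 𝒜 (I ^ n)) := by
  classical
  have hmul : ∀ (J K : Ideal R) (a b : ℕ), (Finset.range (a + 1)).sup (piece 𝒜 J) *
      (Finset.range (b + 1)).sup (piece 𝒜 K) ≤ (Finset.range (a + b + 1)).sup (piece 𝒜 (J * K)) := by
    intro J K a b
    simp only [Finset.sup_eq_iSup, Submodule.iSup_mul, Submodule.mul_iSup, iSup_le_iff]
    intro i hi j hj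
    rw [Finset.mem_range] at hi hj
    refine le_trans ?_ (le_iSup₂_of_le (j + i) (Finset.mem_range.2 (by omega)) le_rfl)
    rw [Submodule.mul_le]
    intro x hx y hy
    exact ⟨Ideal.mul_mem_mul hx.1 hy.1, SetLike.GradedMul.mul_mem hx.2 hy.2⟩
  induction n with
  | zero =>
    rw [pow_zero, pow_zero, mul_zero, Submodule.one_le]
    refine (Finset.le_sup (f := piece 𝒜 1) (b := 0) (by simp)) ?_
    refine ⟨?_, SetLike.GradedOne.one_mem⟩
    rw [Ideal.one_eq_top]; exact Submodule.mem_top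
  | succ n ih =>
    rw [pow_succ, pow_succ, mul_add, mul_one]
    exact (mul_le_mul' ih le_rfl).trans (hmul _ _ _ _)

open Pointwise in
theorem le_sup_pieces (hstd : Algebra.adjoin k (𝒜 1 : Set R) = ⊤) (I : Ideal R) (e n : ℕ)
    (s : Finset R) (hs : ∀ f ∈ s, ∃ i < e, f ∈ 𝒜 i) (hI : I = Ideal.span ↑s) :
    (Finset.range (e * n + 1)).sup (piece 𝒜 (I ^ n)) ≤
      ((Finset.range (e + 1)).sup (piece 𝒜 I)) ^ n := by
  classical
  set V := (Finset.range (e + 1)).sup (piece 𝒜 I) with hV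
  have hVmem : ∀ j ≤ e, ∀ x ∈ I, x ∈ 𝒜 j → x ∈ V := by
    intro j hj x hx hxj
    exact (Finset.le_sup (f := piece 𝒜 I) (b := j) (Finset.mem_range.2 (by omega))) ⟨hx, hxj⟩
  have hG : ∀ n, ∀ t ∈ (s : Set R) ^ n, ∃ D ≤ e * n, t ∈ 𝒜 D ∧
      ∀ b, b + D ≤ e * n → ∀ r ∈ 𝒜 b, r * t ∈ V ^ n := by
    intro n
    induction n with
    | zero =>
      intro t ht
      rw [pow_zero, Set.mem_one] at ht
      subst ht
      refine ⟨0, by simp, SetLike.GradedOne.one_mem, ?_⟩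
      intro b hb r hr
      have : b = 0 := by omega
      subst this
      rw [grade_eq_pow 𝒜 hstd, pow_zero] at hr
      rwa [mul_one, pow_zero]
    | succ n ih =>
      intro t ht
      rw [pow_succ] at ht
      obtain ⟨u, hu, f, hf, rfl⟩ := Set.mem_mul.1 ht
      obtain ⟨D, hD, huD, hub⟩ := ih u hu
      obtain ⟨j, hj, hfj⟩ := hs f hf
      refine ⟨D + j, by rw [mul_add]; omega, SetLike.GradedMul.mul_mem huD hfj, ?_⟩
      intro b hb r hr
      rw [mul_add, mul_one] at hb
      obtain ⟨b1, b2, rfl, h1, h2⟩ : ∃ b1 b2, b = b1 + b2 ∧ b1 + D ≤ e * n ∧ b2 + j ≤ e := by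
        refine ⟨b - min b (e - j), min b (e - j), ?_, ?_, ?_⟩ <;> omega
      rw [grade_eq_pow 𝒜 hstd, pow_add, ← grade_eq_pow 𝒜 hstd, ← grade_eq_pow 𝒜 hstd] at hr
      induction hr using Submodule.mul_induction_on' with
      | mem_mul_mem x hx y hy =>
        rw [mul_mul_mul_comm, pow_succ]
        refine Submodule.mul_mem_mul (hub b1 h1 x hx) (hVmem _ h2 _ ?_ ?_)
        · rw [hI]; exact Ideal.mul_mem_left _ _ (Ideal.subset_span hf)
        · exact SetLike.GradedMul.mul_mem hy hfj
      | add x _ y _ hx hy =>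
        rw [add_mul]; exact add_mem hx hy
  have key : ∀ x ∈ I ^ n, ∀ i ≤ e * n, (DirectSum.decompose 𝒜 x i : R) ∈ V ^ n := by
    intro x hx
    have hx' : x ∈ Submodule.span R ((s : Set R) ^ n) := by
      rw [← Submodule.span_pow]
      rw [hI] at hx
      exact hx
    clear hx
    have gen : ∀ r : R, ∀ i ≤ e * n, (DirectSum.decompose 𝒜 (r * x) i : R) ∈ V ^ n := by
      induction hx' using Submodule.span_induction with
      | mem t ht =>
        intro r i hi
        obtain ⟨D, hD, htD, hb⟩ := hG n t ht
        rw [DirectSum.coe_decompose_mul_of_right_mem 𝒜 i htD]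
        split_ifs with h
        · exact hb _ (by omega) _ (SetLike.coe_mem _)
        · exact zero_mem _
      | zero => intro r i hi; simp
      | add x y _ _ hx hy =>
        intro r i hi
        rw [mul_add, DirectSum.decompose_add, DirectSum.add_apply, Submodule.coe_add]
        exact add_mem (hx r i hi) (hy r i hi)
      | smul a x _ hx =>
        intro r i hi
        rw [smul_eq_mul, ← mul_assoc]
        exact hx (r * a) i hi
    intro i hi
    simpa using gen 1 i hi
  apply Finset.sup_le
  intro i hi x hx
  have := key x hx.1 i (by have := Finset.mem_range.1 hi; omega)
  rwa [DirectSum.decompose_of_mem_same 𝒜 hx.2] at this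

theorem finrank_reesPiece (hfin : ∀ (J : Ideal R) (i : ℕ), FiniteDimensional k (piece 𝒜 J i))
    (I : Ideal R) (e n : ℕ) :
    (∑ i ∈ Finset.range (e * n + 1), Module.finrank k (piece 𝒜 (I ^ n) i)) =
        Module.finrank k (reesPiece 𝒜 I e n) := by
  classical
  let φ : (Π i : Fin (e * n + 1), piece 𝒜 (I ^ n) (e * n - i)) →ₗ[k] Polynomial (Polynomial R) :=
    { toFun := fun f => monomial n (∑ i : Fin (e * n + 1), monomial (i : ℕ) (f i : R))
      map_add' := by
        intro f g
        simp [Finset.sum_add_distrib]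
      map_smul' := by
        intro c f
        simp only [Pi.smul_apply, Submodule.coe_smul, RingHom.id_apply, ← smul_monomial,
          ← Finset.smul_sum] }
  have hcoef : ∀ (f : Π i : Fin (e * n + 1), R) (j : ℕ),
      (∑ i : Fin (e * n + 1), monomial (i : ℕ) (f i)).coeff j =
        if h : j < e * n + 1 then f ⟨j, h⟩ else 0 := by
    intro f j
    rw [finsetSum_coeff]
    simp only [coeff_monomial]
    split_ifs with h
    · rw [Finset.sum_eq_single ⟨j, h⟩]
      · simp
      · intro b _ hb
        rw [if_neg]
        intro h'
        exact hb (Fin.ext h')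
      · simp
    · apply Finset.sum_eq_zero
      intro i _
      rw [if_neg]
      have := i.2
      omega
  have hinj : Function.Injective φ := by
    intro f g hfg
    have h1 := monomial_injective n hfg
    funext i
    have h2 := congrArg (fun p => p.coeff (i : ℕ)) h1
    simp only [hcoef (fun i => (f i : R)), hcoef (fun i => (g i : R)), i.2, dif_pos] at h2
    exact Subtype.ext h2
  have hrange : LinearMap.range φ = reesPiece 𝒜 I e n := by
    ext x
    constructor
    · rintro ⟨f, rfl⟩
      refine ⟨_, rfl, fun j => ?_⟩
      rw [hcoef (fun i => (f i : R))]
      by_cases h : j < e * n + 1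
      · rw [dif_pos h, if_pos (by omega)]
        exact (f ⟨j, h⟩).2
      · rw [dif_neg h]
        exact zero_mem _
    · rintro ⟨p, rfl, hp⟩
      refine ⟨fun i => ⟨p.coeff i, ?_⟩, ?_⟩
      · have := hp i
        rw [if_pos (by have := i.2; omega)] at this
        exact this
      · change monomial n (∑ i : Fin (e * n + 1), monomial (i : ℕ) (p.coeff i)) = monomial n p
        congr 1
        ext j
        rw [hcoef (fun i => p.coeff i)]
        split_ifs with h
        · rfl
        · have := hp j
          rw [if_neg (by omega), inf_bot_eq] at this
          exact ((Submodule.mem_bot k).1 this).symm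
  rw [← hrange, LinearMap.finrank_range_of_inj hinj]
  have := hfin (I ^ n)
  rw [Module.finrank_pi_fintype,
    Fin.sum_univ_eq_sum_range (fun i => Module.finrank k (piece 𝒜 (I ^ n) (e * n - i))),
    ← Finset.sum_range_reflect]
  apply Finset.sum_congr rfl
  intro i hi
  rfl
end graded

theorem statement14 (k : Type) [Field k]
    (R : Type) [CommRing R] [IsDomain R] [Algebra k R]
    (𝒜 : ℕ → Submodule k R) [GradedAlgebra 𝒜]
    -- `R` is a finitely generated graded domain over `k`
    (hFG : Algebra.FiniteType k R)
    (hstd : Algebra.adjoin k (𝒜 1 : Set R) = ⊤)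
    -- `d = dim R`
    (d : ℕ) (hd : ringKrullDim R = d)
    -- a homogeneous ideal of height `≥ 1` generated in degrees `< e`
    (I : Ideal R) (hI : I.IsHomogeneous 𝒜) (hht : 1 ≤ idealHeight I)
    (e : ℕ)
    (hgen : ∃ s : Finset R, (∀ f ∈ s, ∃ i < e, f ∈ 𝒜 i) ∧ I = Ideal.span ↑s) :
    -- `τ(n) = Σ_{i=0}^{en} dim_k (Iⁿ)_i` is eventually a polynomial of degree `≤ d` in `n`
    (∃ P : Polynomial ℚ, P.natDegree ≤ d ∧ ∃ N : ℕ, ∀ n : ℕ, N ≤ n →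
      ((∑ i ∈ Finset.range (e * n + 1),
          Module.finrank k (piece 𝒜 (I ^ n) i) : ℕ) : ℚ) = P.eval (n : ℚ)) ∧
    -- consequently the limit `lim τ(n)/n^d` exists and is rational
    (∃ L : ℚ,
      Tendsto (fun n : ℕ =>
          ((∑ i ∈ Finset.range (e * n + 1),
            Module.finrank k (piece 𝒜 (I ^ n) i) : ℕ) : ℝ) / (n : ℝ) ^ d)
        atTop (nhds (L : ℝ))) ∧
    -- moreover `τ(n) = dim_k S_{(en,n)}` for the bigraded Rees algebra `S`
    (∀ n : ℕ,
      (∑ i ∈ Finset.range (e * n + 1), Module.finrank k (piece 𝒜 (I ^ n) i)) =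
        Module.finrank k (reesPiece 𝒜 I e n)) := by
  classical
  obtain ⟨s, hs, hIs⟩ := hgen
  have hfin : ∀ (J : Ideal R) (i : ℕ), FiniteDimensional k (piece 𝒜 J i) :=
    piece_finite 𝒜 hFG hstd
  set V : Submodule k R := (Finset.range (e + 1)).sup (piece 𝒜 I) with hV
  have hVfg : V.FG := Module.Finite.iff_fg.1 (finrank_sup_pieces 𝒜 I (hfin I) (e + 1)).1
  have hτ : ∀ n, (∑ i ∈ Finset.range (e * n + 1), Module.finrank k (piece 𝒜 (I ^ n) i)) =
      Module.finrank k (V ^ n : Submodule k R) := by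
    intro n
    rw [← (finrank_sup_pieces 𝒜 (I ^ n) (hfin _) (e * n + 1)).2,
      le_antisymm (le_sup_pieces 𝒜 hstd I e n s hs hIs) (sup_pieces_le 𝒜 I e n)]
  obtain ⟨P, N, hP⟩ := hilbert_pow V hVfg
  obtain ⟨C, hC⟩ := growth_bound hFG d hd V hVfg
  have hdeg : P.natDegree ≤ d :=
    natDegree_le_of_growth P N d C (fun n => Module.finrank k (V ^ n : Submodule k R)) hP hC
  refine ⟨⟨P, hdeg, N, fun n hn => ?_⟩, ⟨P.coeff d, ?_⟩, ?_⟩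
  · rw [hτ n]
    exact hP n hn
  · simp only [hτ]
    exact limit_of_poly P N d (fun n => Module.finrank k (V ^ n : Submodule k R)) hP hdeg
  · exact finrank_reesPiece 𝒜 hfin I e
end

section
/- Let k be a field of characteristic zero, R a graded domain over k which is the quotient of a polynomial ring by a homogeneous prime ideal, m its maximal homogeneous ideal, d = dim R, and assume depth(R_m) ≥ 2. Let I ⊆ R be a homogeneous ideal of height ≥ 1 and let e be an integer exceeding the degrees of a set of homogeneous generators of I and the Swanson linear bound for I. Define σ(n) = Σ_{m=0}^{en} dim_k ((I^n)^*)_m, where (I^n)^* = (I^n : m^∞) is the saturation of I^n. Then the limit lim_{n→∞} σ(n)/n^d exists. -/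
/-!
STATEMENT 17: Let `k` be a field of characteristic zero, `R` a graded domain over `k` which is
the quotient of a polynomial ring by a homogeneous prime ideal, `m` its maximal homogeneous
ideal, `d = dim R`, and assume `depth(R_m) ≥ 2`.  Let `I ⊆ R` be a homogeneous ideal of height
`≥ 1` and let `e` be an integer exceeding the degrees of a set of homogeneous generators of `I`
and the Swanson linear bound for `I`.  Define `σ(n) = Σ_{m=0}^{en} dim_k ((Iⁿ)^*)_m`, where
`(Iⁿ)^* = (Iⁿ : m^∞)` is the saturation of `Iⁿ`.  Then the limit `lim_{n→∞} σ(n)/n^d` exists.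

`R` is modelled as a finitely generated standard ℕ-graded `k`-algebra domain; `m` is the
irrelevant ideal; `depth(R_m) ≥ 2` is expressed by a length-two regular sequence on `R`
inside `m`.
-/

open Filter

/-- The saturation `(I : J^∞) = ⋃ j (I : J^j)` of `I` with respect to `J`. -/
noncomputable def sat {R : Type*} [CommRing R] (I J : Ideal R) : Ideal R :=
  ⨆ j : ℕ, Submodule.colon (I : Submodule R R) (J ^ j : Ideal R)

/-- Integral injective extensions preserve Krull dimension. -/
theorem aux_krullDim_eq {S R : Type*} [CommRing S] [CommRing R] [IsDomain R] [Algebra S R]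
    [Algebra.IsIntegral S R] (hinj : Function.Injective (algebraMap S R)) :
    ringKrullDim R = ringKrullDim S := by
  apply le_antisymm
  · refine Order.krullDim_le_of_strictMono (PrimeSpectrum.comap (algebraMap S R)) ?_
    intro p q hpq
    exact Ideal.IsIntegral.comap_lt_comap (R := S) (I := p.asIdeal) (J := q.asIdeal) hpq
  · refine iSup_le fun l => ?_
    obtain ⟨P, -, hP, hPl⟩ := Ideal.exists_ideal_over_prime_of_isIntegral
      (S := R) (RelSeries.head l).asIdeal (⊥ : Ideal R)
      (by rw [Ideal.comap_bot_of_injective _ hinj]; exact bot_le)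
    have := hP
    have : P.LiesOver (RelSeries.head l).asIdeal := ⟨hPl.symm⟩
    obtain ⟨L, hL, -, -⟩ := Ideal.exists_ltSeries_of_hasGoingUp l P
    rw [← hL]
    exact le_iSup (fun p : LTSeries (PrimeSpectrum R) => ((p.length : ℕ∞) : WithBot ℕ∞)) L

section val
variable {R : Type*} [CommRing R] {Γ₀ : Type*} [LinearOrderedCommGroupWithZero Γ₀]

theorem aux_val_sum (v : Valuation R Γ₀) {ι : Type*} (s : Finset ι) (hs : s.Nonempty) (x : ι → R)
    (h0 : ∀ i ∈ s, v (x i) ≠ 0) (hinj : Set.InjOn (fun i => v (x i)) s) :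
    ∃ j ∈ s, v (∑ i ∈ s, x i) = v (x j) := by
  classical
  obtain ⟨j, hj, hmax⟩ := s.exists_max_image (fun i => v (x i)) hs
  refine ⟨j, hj, v.map_sum_eq_of_lt hj fun i hi => ?_⟩
  simp only [Finset.mem_sdiff, Finset.mem_singleton] at hi
  refine lt_of_le_of_ne (hmax i hi.1) fun h => hi.2 (hinj hi.1 hj h)

variable {k : Type*} [Field k] [Algebra k R]

/-- elements of value `< γ` -/
def auxLt (v : Valuation R Γ₀) (hk : ∀ c : k, c ≠ 0 → v (algebraMap k R c) = 1) (γ : Γ₀)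
    (hγ : γ ≠ 0) : Submodule k R where
  carrier := {x | v x < γ}
  zero_mem' := by simpa using zero_lt_iff.2 hγ
  add_mem' := fun {a b} ha hb => v.map_add_lt ha hb
  smul_mem' := by
    intro c x hx
    by_cases hc : c = 0
    · subst hc; simpa using zero_lt_iff.2 hγ
    · simpa [Algebra.smul_def, hk c hc] using hx

theorem aux_leaves (v : Valuation R Γ₀) (hk : ∀ c : k, c ≠ 0 → v (algebraMap k R c) = 1)
    (h0 : ∀ x : R, v x = 0 → x = 0) (n : ℕ) : ∀ (V : Submodule k R), FiniteDimensional k V →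
    Module.finrank k V = n →
    ∃ (S : Finset Γ₀) (L : Γ₀ → Submodule k R), (∀ γ ∈ S, L γ ≤ V ∧ (∃ x ∈ L γ, x ≠ 0) ∧
      ∀ x ∈ L γ, x ≠ 0 → v x = γ) ∧ Module.finrank k V ≤ ∑ γ ∈ S, Module.finrank k (L γ) := by
  classical
  induction n using Nat.strong_induction_on with
  | _ n ih =>
  intro V hV hn
  by_cases hn0 : n = 0
  · exact ⟨∅, fun _ => ⊥, by simp, by simp [hn, hn0]⟩
  have hVn : Module.finrank k V ≠ 0 := by omega
  let b := Module.finBasis k V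
  have : Nonempty (Fin (Module.finrank k V)) := ⟨⟨0, by omega⟩⟩
  obtain ⟨i0, -, hmax⟩ := (Finset.univ : Finset (Fin (Module.finrank k V))).exists_max_image
    (fun i => v (b i : R)) Finset.univ_nonempty
  set γ := v (b i0 : R) with hγdef
  have hbne : (b i0 : R) ≠ 0 := by
    simpa using b.ne_zero i0
  have hγ : γ ≠ 0 := fun h => hbne (h0 _ h)
  have hle : ∀ x ∈ V, v x ≤ γ := by
    intro x hx
    have := b.sum_repr ⟨x, hx⟩
    have h2 := congrArg (fun y : V => (y : R)) this
    simp only [Submodule.coe_sum, Submodule.coe_smul] at h2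
    rw [← h2]
    refine v.map_sum_le fun i _ => ?_
    by_cases hc : (b.repr ⟨x, hx⟩) i = 0
    · simp [hc]
    · rw [Algebra.smul_def, map_mul, hk _ hc, one_mul]
      exact hmax i (Finset.mem_univ _)
  let W : Submodule k R := V ⊓ auxLt v hk γ hγ
  have hWV : W < V := by
    refine lt_of_le_of_ne inf_le_left fun h => ?_
    have h1 : (b i0 : R) ∈ W := h.ge (b i0).2
    exact lt_irrefl _ h1.2
  have hWfd : FiniteDimensional k W := Submodule.finiteDimensional_of_le hWV.le
  have hWlt := Submodule.finrank_lt_finrank_of_lt hWV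
  obtain ⟨S, L, hSL, hsum⟩ := ih _ (hn ▸ hWlt) W hWfd rfl
  obtain ⟨C, hC⟩ := Submodule.exists_isCompl W
  have hdis : W ⊓ (V ⊓ C) = ⊥ := by
    rw [eq_bot_iff, ← hC.inf_eq_bot]
    exact inf_le_inf_left _ inf_le_right
  have hsup : W ⊔ (V ⊓ C) = V := by
    rw [inf_comm, ← sup_inf_assoc_of_le _ hWV.le, hC.sup_eq_top, top_inf_eq]
  have hCfd : FiniteDimensional k (V ⊓ C : Submodule k R) :=
    Submodule.finiteDimensional_of_le inf_le_left
  have hfr := Submodule.finrank_sup_add_finrank_inf_eq W (V ⊓ C)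
  rw [hsup, hdis, finrank_bot, add_zero] at hfr
  have hγS : γ ∉ S := by
    intro h
    obtain ⟨h1, ⟨x, hx, hx0⟩, h3⟩ := hSL γ h
    have h4 : v x < γ := (h1 hx).2
    rw [h3 x hx hx0] at h4
    exact lt_irrefl _ h4
  refine ⟨insert γ S, Function.update L γ (V ⊓ C), ?_, ?_⟩
  · intro γ' hγ'
    by_cases hγγ : γ' = γ
    · subst hγγ
      rw [Function.update_self]
      refine ⟨inf_le_left, ?_, ?_⟩
      · by_contra hcon
        push Not at hcon
        have : (V ⊓ C : Submodule k R) = ⊥ := (Submodule.eq_bot_iff _).2 hcon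
        rw [this, finrank_bot] at hfr
        omega
      · intro x hx hx0
        refine le_antisymm (hle x hx.1) ?_
        by_contra hlt
        rw [not_le] at hlt
        have : x ∈ W ⊓ (V ⊓ C) := ⟨⟨hx.1, hlt⟩, hx⟩
        rw [hdis] at this
        exact hx0 this
    · rw [Function.update_of_ne hγγ]
      have := hSL γ' ((Finset.mem_insert.1 hγ').resolve_left hγγ)
      exact ⟨this.1.trans hWV.le, this.2⟩
  · rw [Finset.sum_insert hγS, Function.update_self, hfr, add_comm]
    refine Nat.add_le_add_left (hsum.trans (le_of_eq (Finset.sum_congr rfl ?_))) _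
    intro γ' hγ'
    rw [Function.update_of_ne]
    rintro rfl
    exact hγS hγ'

theorem aux_indep (v : Valuation R Γ₀)
    (h0 : ∀ x : R, v x = 0 → x = 0) (W : Submodule k R) [FiniteDimensional k W]
    {J : Type*} [Fintype J] (M : J → Submodule k R) (hM : ∀ j, M j ≤ W) (δ : J → Γ₀)
    (hδ : Function.Injective δ) (hMδ : ∀ j, ∀ x ∈ M j, x ≠ 0 → v x = δ j) :
    ∑ j, Module.finrank k (M j) ≤ Module.finrank k W := by
  classical
  have : ∀ j, FiniteDimensional k (M j) := fun j => Submodule.finiteDimensional_of_le (hM j)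
  rw [← Module.finrank_pi_fintype k]
  let f : ((j : J) → M j) →ₗ[k] W := ∑ j, (Submodule.inclusion (hM j)).comp (LinearMap.proj j)
  refine LinearMap.finrank_le_finrank_of_injective (f := f) ?_
  rw [injective_iff_map_eq_zero]
  intro x hx
  have hx' : ∑ j, (x j : R) = 0 := by
    have := congrArg (fun y : W => (y : R)) hx
    simpa [f] using this
  by_contra hne
  let s : Finset J := Finset.univ.filter fun j => (x j : R) ≠ 0
  have hs : s.Nonempty := by
    by_contra hs
    rw [Finset.not_nonempty_iff_eq_empty, Finset.filter_eq_empty_iff] at hs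
    exact hne (funext fun j => by simpa using hs (Finset.mem_univ j))
  have hss : ∑ j ∈ s, (x j : R) = 0 := by
    rw [← hx']; exact Finset.sum_filter_ne_zero _
  obtain ⟨j, hj, hjv⟩ := aux_val_sum v s hs (fun j => (x j : R))
    (fun i hi h => (Finset.mem_filter.1 hi).2 (h0 _ h))
    (fun i hi j hj h => hδ (by
      have hi' := hMδ i _ (x i).2 (Finset.mem_filter.1 hi).2
      have hj' := hMδ j _ (x j).2 (Finset.mem_filter.1 hj).2
      rw [← hi', ← hj']; exact h))
  rw [hss, map_zero] at hjv
  exact (Finset.mem_filter.1 hj).2 (h0 _ hjv.symm)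
end val

theorem aux_ext_val {L Ω : Type*} [Field L] [Field Ω] [Algebra L Ω] {Γ₁ : Type*}
    [LinearOrderedCommGroupWithZero Γ₁] (w : Valuation L Γ₁) :
    ∃ B : ValuationSubring Ω, (∀ x, w x ≤ 1 → B.valuation (algebraMap L Ω x) ≤ 1) ∧
      (∀ x, w x < 1 → B.valuation (algebraMap L Ω x) < 1) := by
  let O := w.valuationSubring
  let A : Subring Ω := O.toSubring.map (algebraMap L Ω)
  let e : O.toSubring ≃+* A := O.toSubring.equivMapOfInjective _ (algebraMap L Ω).injective
  let I : Ideal A := Ideal.comap e.symm.toRingHom (IsLocalRing.maximalIdeal O : Ideal O)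
  have hI : I ≠ ⊤ := Ideal.comap_ne_top _ (IsLocalRing.maximalIdeal.isMaximal O).ne_top
  obtain ⟨B, hAB, hIB⟩ := Ideal.image_subset_nonunits_valuationSubring I hI
  refine ⟨B, fun x hx => ?_, fun x hx => ?_⟩
  · rw [ValuationSubring.valuation_le_one_iff]
    exact hAB ⟨x, hx, rfl⟩
  · rw [← ValuationSubring.mem_nonunits_iff]
    have hxO : x ∈ O.toSubring := hx.le
    refine hIB ⟨e ⟨x, hxO⟩, ?_, rfl⟩
    change e.symm (e ⟨x, hxO⟩) ∈ (IsLocalRing.maximalIdeal O : Ideal O)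
    rw [RingEquiv.symm_apply_apply]
    exact (Valuation.mem_maximalIdeal_iff (v := w) (a := ⟨x, hxO⟩)).2 hx

theorem aux_single_zpow {Γ k : Type*} [AddCommGroup Γ] [LinearOrder Γ] [IsOrderedAddMonoid Γ]
    [Field k] (g : Γ) (z : ℤ) :
    (HahnSeries.single g (1 : k)) ^ z = HahnSeries.single (z • g) (1 : k) := by
  have h : ∀ n : ℕ, (HahnSeries.single g (1 : k)) ^ n = HahnSeries.single (n • g) (1 : k) := by
    intro n; rw [HahnSeries.single_pow, one_pow]
  obtain ⟨n, rfl | rfl⟩ := z.eq_nat_or_neg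
  · rw [zpow_natCast, h, natCast_zsmul]
  · rw [zpow_neg, zpow_natCast, h, neg_smul, natCast_zsmul]
    symm
    apply eq_inv_of_mul_eq_one_left
    rw [HahnSeries.single_mul_single]; simp

theorem aux_hahn (k : Type) [Field k] (d : ℕ) :
   ∃ (L : Type) (_ : Field L) (φ : MvPolynomial (Fin d) k →+* L) (Γ₁ : Type)
    (_ : LinearOrderedCommGroupWithZero Γ₁) (w : Valuation L Γ₁),
    (∀ c : k, c ≠ 0 → w (φ (MvPolynomial.C c)) = 1) ∧ (∀ i, w (φ (MvPolynomial.X i)) ≠ 0) ∧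
    ∀ β : Fin d → ℤ, ∏ i, w (φ (MvPolynomial.X i)) ^ β i = 1 → β = 0 := by
  let Γ := Lex (Fin d → ℤ)
  let w := (HahnSeries.addVal Γ k).toValuation
  let φ : MvPolynomial (Fin d) k →ₐ[k] HahnSeries Γ k :=
    MvPolynomial.aeval (fun i => HahnSeries.single (toLex (Pi.single i 1)) 1)
  have hw : ∀ (g : Γ) (c : k), c ≠ 0 → w (HahnSeries.single g c) =
      Multiplicative.ofAdd (OrderDual.toDual (g : WithTop Γ)) := by
    intro g c hc
    simp only [w]
    rw [AddValuation.toValuation_apply, HahnSeries.addVal_apply, HahnSeries.orderTop_single hc]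
  have hX : ∀ i, φ.toRingHom (MvPolynomial.X i) =
      HahnSeries.single (toLex (Pi.single i 1)) 1 := by
    intro i
    exact MvPolynomial.aeval_X _ i
  refine ⟨HahnSeries Γ k, inferInstance, φ.toRingHom, Multiplicative (WithTop Γ)ᵒᵈ, inferInstance,
    w, ?_, ?_, ?_⟩
  · intro c hc
    have : φ.toRingHom (MvPolynomial.C c) = HahnSeries.single 0 c := by
      change φ (MvPolynomial.C c) = _
      rw [MvPolynomial.aeval_C]; rfl
    rw [this, hw _ _ hc]; rfl
  · intro i
    rw [hX, Valuation.ne_zero_iff]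
    exact HahnSeries.single_ne_zero one_ne_zero
  · intro β hβ
    simp only [hX] at hβ
    have h1 : ∀ s : Finset (Fin d), ∏ i ∈ s, (HahnSeries.single (toLex (Pi.single i 1) : Γ) (1:k)) ^ β i
      = HahnSeries.single (∑ i ∈ s, β i • (toLex (Pi.single i 1) : Γ)) 1 := by
      classical
      intro s
      induction s using Finset.induction_on with
      | empty => simp
      | insert a s ha ih =>
        rw [Finset.prod_insert ha, ih, Finset.sum_insert ha, aux_single_zpow,
          HahnSeries.single_mul_single, one_mul]
    have h2 : w (∏ i, (HahnSeries.single (toLex (Pi.single i 1) : Γ) (1:k)) ^ β i) = 1 := by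
      rw [map_prod]; simpa only [map_zpow₀] using hβ
    rw [h1, hw _ _ one_ne_zero] at h2
    have h3 : (∑ i, β i • (toLex (Pi.single i 1) : Γ)) = 0 := by
      have h4 : ((∑ i, β i • (toLex (Pi.single i 1) : Γ) : Γ) : WithTop Γ) = (0 : WithTop Γ) := h2
      exact_mod_cast h4
    have h5 : (∑ i, β i • (Pi.single i 1 : Fin d → ℤ)) = 0 := h3
    funext j
    have := congrFun h5 j
    simpa [Finset.sum_apply, Pi.single_apply] using this

/-- monomial value independence transferred to an algebraically closed field -/
theorem aux_val_alg (k : Type) [Field k] (d : ℕ) :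
   ∃ (L : Type) (_ : Field L) (_ : IsAlgClosed L) (φ : MvPolynomial (Fin d) k →+* L) (Γ₁ : Type)
    (_ : LinearOrderedCommGroupWithZero Γ₁) (w : Valuation L Γ₁),
    (∀ c : k, c ≠ 0 → w (φ (MvPolynomial.C c)) = 1) ∧ (∀ i, w (φ (MvPolynomial.X i)) ≠ 0) ∧
    ∀ β : Fin d → ℤ, ∏ i, w (φ (MvPolynomial.X i)) ^ β i = 1 → β = 0 := by
  obtain ⟨L, _, φ, Γ₁, _, w, h1, h2, h3⟩ := aux_hahn k d
  obtain ⟨B, hB1, hB2⟩ := aux_ext_val (Ω := AlgebraicClosure L) w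
  have hone : ∀ x, w x = 1 → B.valuation (algebraMap L (AlgebraicClosure L) x) = 1 := by
    intro x hx
    apply le_antisymm (hB1 x hx.le)
    have := hB1 x⁻¹ (by rw [map_inv₀, hx, inv_one])
    rw [map_inv₀, map_inv₀] at this
    have hx0 : x ≠ 0 := by rintro rfl; simp at hx
    have hpos : 0 < B.valuation (algebraMap L (AlgebraicClosure L) x) := by
      rw [zero_lt_iff, Valuation.ne_zero_iff]; simpa using hx0
    exact (inv_le_one₀ hpos).1 this
  have hne : ∀ x, x ≠ 0 → w x ≠ 1 → B.valuation (algebraMap L (AlgebraicClosure L) x) ≠ 1 := by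
    intro x hx0 hx
    rcases lt_or_gt_of_ne hx with h | h
    · exact (hB2 x h).ne
    · have := hB2 x⁻¹ (by rw [map_inv₀]; exact inv_lt_one_of_one_lt₀ h)
      rw [map_inv₀, map_inv₀] at this
      intro h'
      rw [h', inv_one] at this
      exact lt_irrefl _ this
  refine ⟨AlgebraicClosure L, inferInstance, inferInstance, (algebraMap L _).comp φ, B.ValueGroup,
    inferInstance, B.valuation, ?_, ?_, ?_⟩
  · intro c hc
    exact hone _ (h1 c hc)
  · intro i
    have := h2 i
    rw [Valuation.ne_zero_iff] at this ⊢
    simpa using this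
  · intro β hβ
    apply h3
    by_contra hcon
    have e1 : ∏ i, w (φ (MvPolynomial.X i)) ^ β i = w (∏ i, φ (MvPolynomial.X i) ^ β i) := by
      rw [map_prod]; simp only [map_zpow₀]
    rw [e1] at hcon
    refine hne _ ?_ hcon ?_
    · refine Finset.prod_ne_zero_iff.2 fun i _ => zpow_ne_zero _ ?_
      exact (Valuation.ne_zero_iff _).1 (h2 i)
    · rw [← hβ, map_prod, map_prod]
      simp only [map_zpow₀, RingHom.comp_apply]

theorem aux_mono_val {k L : Type*} [Field k] [CommRing L] {d : ℕ}
    (φ : MvPolynomial (Fin d) k →+* L)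
    {Γ₁ : Type*} [LinearOrderedCommGroupWithZero Γ₁] (w : Valuation L Γ₁)
    (h1 : ∀ c : k, c ≠ 0 → w (φ (MvPolynomial.C c)) = 1) (m : Fin d →₀ ℕ) (c : k) (hc : c ≠ 0) :
    w (φ (MvPolynomial.monomial m c)) = ∏ i, w (φ (MvPolynomial.X i)) ^ (m i : ℤ) := by
  rw [MvPolynomial.monomial_eq, map_mul, map_mul, h1 c hc, one_mul, Finsupp.prod_fintype _ _ (by simp),
    map_prod, map_prod]
  simp

theorem aux_poly_val {k L : Type*} [Field k] [CommRing L] {d : ℕ}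
    (φ : MvPolynomial (Fin d) k →+* L)
    {Γ₁ : Type*} [LinearOrderedCommGroupWithZero Γ₁] (w : Valuation L Γ₁)
    (h1 : ∀ c : k, c ≠ 0 → w (φ (MvPolynomial.C c)) = 1) (h2 : ∀ i, w (φ (MvPolynomial.X i)) ≠ 0)
    (h3 : ∀ β : Fin d → ℤ, ∏ i, w (φ (MvPolynomial.X i)) ^ β i = 1 → β = 0)
    (p : MvPolynomial (Fin d) k) (hp : p ≠ 0) :
    ∃ μ : Fin d → ℤ, w (φ p) = ∏ i, w (φ (MvPolynomial.X i)) ^ μ i := by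
  have hs : p.support.Nonempty := MvPolynomial.support_nonempty.2 hp
  have hc : ∀ m ∈ p.support, p.coeff m ≠ 0 := fun m hm => MvPolynomial.mem_support_iff.1 hm
  have hmv := aux_mono_val φ w h1
  obtain ⟨m, hm, hv⟩ := aux_val_sum w p.support hs
    (fun m => φ (MvPolynomial.monomial m (p.coeff m))) (by
      intro m hm
      rw [hmv m _ (hc m hm)]
      exact Finset.prod_ne_zero_iff.2 fun i _ => zpow_ne_zero _ (h2 i))
    (by
      intro m hm m' hm' h
      simp only at h
      rw [hmv m _ (hc m hm), hmv m' _ (hc m' hm')] at h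
      have := h3 (fun i => (m i : ℤ) - m' i) (by
        simp only [zpow_sub₀ (h2 _)]
        rw [Finset.prod_div_distrib, h, div_self]
        exact Finset.prod_ne_zero_iff.2 fun i _ => zpow_ne_zero _ (h2 i))
      ext i
      have h := congrFun this i
      simp only [Pi.zero_apply] at h
      omega)
  refine ⟨fun i => (m i : ℤ), ?_⟩
  rw [← hmv m _ (hc m hm), ← hv, ← map_sum, MvPolynomial.support_sum_monomial_coeff]

theorem aux_val_R {k R : Type} [Field k] [CommRing R] [IsDomain R] [Algebra k R] {d : ℕ}
    (g : MvPolynomial (Fin d) k →ₐ[k] R) (hg : Function.Injective g) (hfin : g.Finite) :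
    ∃ (Γ₁ : Type) (_ : LinearOrderedCommGroupWithZero Γ₁) (v : Valuation R Γ₁) (N : ℕ),
      0 < N ∧ (∀ c : k, c ≠ 0 → v (algebraMap k R c) = 1) ∧ (∀ x : R, v x = 0 → x = 0) ∧
      (∀ β : Fin d → ℤ, ∏ i, v (g (MvPolynomial.X i)) ^ β i = 1 → β = 0) ∧
      ∀ y : R, y ≠ 0 → ∃ μ : Fin d → ℤ, v y ^ N = ∏ i, v (g (MvPolynomial.X i)) ^ μ i := by
  classical
  obtain ⟨L, _, _, φ, Γ₁, _, w, h1, h2, h3⟩ := aux_val_alg k d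
  have hφ : Function.Injective φ := by
    rw [injective_iff_map_eq_zero]
    intro p hp
    by_contra hp0
    obtain ⟨μ, hμ⟩ := aux_poly_val φ w h1 h2 h3 p hp0
    rw [hp, map_zero] at hμ
    exact (Finset.prod_ne_zero_iff.2 fun i _ => zpow_ne_zero _ (h2 i)) hμ.symm
  let : Algebra (MvPolynomial (Fin d) k) R := g.toRingHom.toAlgebra
  let : Algebra (MvPolynomial (Fin d) k) L := φ.toAlgebra
  have hmfin : Module.Finite (MvPolynomial (Fin d) k) R := hfin
  have : FaithfulSMul (MvPolynomial (Fin d) k) R :=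
    (faithfulSMul_iff_algebraMap_injective _ _).2 hg
  have : FaithfulSMul (MvPolynomial (Fin d) k) L :=
    (faithfulSMul_iff_algebraMap_injective _ _).2 hφ
  have : Algebra.IsIntegral (MvPolynomial (Fin d) k) R := inferInstance
  have : Algebra.IsAlgebraic (MvPolynomial (Fin d) k) R := inferInstance
  let ψ : R →ₐ[MvPolynomial (Fin d) k] L := IsAlgClosed.lift
  have hψg : ∀ p, ψ (g p) = φ p := fun p => ψ.commutes p
  have hψ : Function.Injective ψ := by
    have hker : RingHom.ker ψ.toRingHom = ⊥ := by
      apply Ideal.eq_bot_of_comap_eq_bot (R := MvPolynomial (Fin d) k)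
      rw [eq_bot_iff]
      intro p hp
      have : ψ (g p) = 0 := hp
      rw [hψg] at this
      exact (injective_iff_map_eq_zero φ).1 hφ p this
    exact (RingHom.injective_iff_ker_eq_bot ψ.toRingHom).2 hker
  let v := w.comap ψ.toRingHom
  have hvg : ∀ p, v (g p) = w (φ p) := fun p => by
    change w (ψ (g p)) = _
    rw [hψg]
  have hv0 : ∀ x : R, v x = 0 → x = 0 := fun x hx =>
    (injective_iff_map_eq_zero ψ).1 hψ x ((Valuation.zero_iff _).1 hx)
  obtain ⟨T, hT⟩ := hmfin.fg_top
  refine ⟨Γ₁, inferInstance, v, T.card.factorial, Nat.factorial_pos _, ?_, hv0, ?_, ?_⟩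
  · intro c hc
    rw [← h1 c hc, ← hvg]
    congr 1
    exact (g.commutes c).symm
  · intro β hβ
    apply h3
    simpa only [hvg] using hβ
  · intro y hy
    simp only [hvg]
    have hdep : ¬ LinearIndependent (MvPolynomial (Fin d) k)
        (fun i : Fin (T.card + 1) => y ^ (i : ℕ)) := by
      intro hli
      have := linearIndependent_le_span_aux' _ hli (T : Set R) (by rw [hT]; exact Set.subset_univ _)
      simp at this
    rw [Fintype.not_linearIndependent_iff] at hdep
    obtain ⟨c, hc, i0, hi0⟩ := hdep
    have hvy : v y ≠ 0 := fun h => hy (hv0 _ h)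
    let s : Finset (Fin (T.card + 1)) := Finset.univ.filter fun i => c i ≠ 0
    have hex : ∃ i ∈ s, ∃ j ∈ s, i < j ∧ v (c i • y ^ (i : ℕ)) = v (c j • y ^ (j : ℕ)) := by
      by_contra hcon
      push Not at hcon
      obtain ⟨j, hj, hvj⟩ := aux_val_sum v s ⟨i0, by simpa [s] using hi0⟩
        (fun i => c i • y ^ (i : ℕ)) (by
          intro i hi h
          have := hv0 _ h
          rw [smul_eq_zero] at this
          rcases this with h | h
          · exact (Finset.mem_filter.1 hi).2 h
          · exact pow_ne_zero _ hy h)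
        (by
          intro i hi j hj h
          by_contra hij
          rcases lt_or_gt_of_ne hij with hlt | hlt
          · exact hcon i hi j hj hlt h
          · exact hcon j hj i hi hlt h.symm)
      have hsum : ∑ i ∈ s, c i • y ^ (i : ℕ) = 0 := by
        rw [← hc, Finset.sum_filter]
        refine Finset.sum_congr rfl fun i _ => ?_
        by_cases h : c i = 0 <;> simp [h]
      rw [hsum, map_zero] at hvj
      have := hv0 _ hvj.symm
      rw [smul_eq_zero] at this
      rcases this with h | h
      · exact (Finset.mem_filter.1 hj).2 h
      · exact pow_ne_zero _ hy h
    obtain ⟨i, hi, j, hj, hij, hv⟩ := hex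
    have hsm : ∀ (p : MvPolynomial (Fin d) k) (x : R), p • x = g p * x := fun p x =>
      Algebra.smul_def p x
    obtain ⟨μ, hμ⟩ := aux_poly_val φ w h1 h2 h3 (c i) (Finset.mem_filter.1 hi).2
    obtain ⟨ν, hν⟩ := aux_poly_val φ w h1 h2 h3 (c j) (Finset.mem_filter.1 hj).2
    rw [hsm, hsm, map_mul, map_mul, hvg, hvg, hμ, hν, map_pow, map_pow] at hv
    have hij' : (i : ℕ) < j := hij
    obtain ⟨r, hr⟩ : ((j : ℕ) - i) ∣ T.card.factorial :=
      Nat.dvd_factorial (by omega) (by have := j.2; omega)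
    have hne : ∏ i, w (φ (MvPolynomial.X i)) ^ ν i ≠ 0 :=
      Finset.prod_ne_zero_iff.2 fun i _ => zpow_ne_zero _ (h2 i)
    have key : v y ^ ((j : ℕ) - i) = ∏ l, w (φ (MvPolynomial.X l)) ^ (μ l - ν l) := by
      simp only [zpow_sub₀ (h2 _)]
      rw [Finset.prod_div_distrib, eq_div_iff hne]
      apply mul_right_cancel₀ (pow_ne_zero (i : ℕ) hvy)
      rw [hv, mul_right_comm, ← pow_add, Nat.sub_add_cancel hij'.le, mul_comm]
    refine ⟨fun l => (μ l - ν l) * r, ?_⟩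
    rw [hr, pow_mul, key, ← Finset.prod_pow]
    refine Finset.prod_congr rfl fun l _ => ?_
    rw [zpow_mul, zpow_natCast]

theorem aux_key {k R : Type*} [Field k] [CommRing R] [IsDomain R] [Algebra k R] {d : ℕ}
    {Γ₁ : Type*} [LinearOrderedCommGroupWithZero Γ₁] (v : Valuation R Γ₁) (N : ℕ) (z : Fin d → R)
    (hk : ∀ c : k, c ≠ 0 → v (algebraMap k R c) = 1) (h0 : ∀ x : R, v x = 0 → x = 0)
    (hind : ∀ β : Fin d → ℤ, ∏ i, v (z i) ^ β i = 1 → β = 0) (hz : ∀ i, z i ≠ 0)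
    (hexp : ∀ y : R, y ≠ 0 → ∃ μ : Fin d → ℤ, v y ^ N = ∏ i, v (z i) ^ μ i)
    (q : ℕ) (hq : 0 < q) (hqN : Nat.Coprime q N) (V W : Submodule k R)
    [FiniteDimensional k V] [FiniteDimensional k W] (c : R) (hc : c ≠ 0)
    (hW : ∀ x ∈ V, ∀ y ∈ V, ∀ β : Fin d → Fin q,
      c * x ^ (q - 1) * (∏ i, z i ^ (β i : ℕ)) * y ∈ W) :
    q ^ d * Module.finrank k V ≤ Module.finrank k W := by
  classical
  have hvz : ∀ i, v (z i) ≠ 0 := fun i h => hz i (h0 _ h)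
  obtain ⟨S, L, hSL, hsum⟩ := aux_leaves v hk h0 _ V inferInstance rfl
  have hx : ∀ γ : S, ∃ x ∈ L γ, x ≠ 0 := fun γ => (hSL γ γ.2).2.1
  choose x hxL hx0 using hx
  have hxv : ∀ γ : S, v (x γ) = γ := fun γ => (hSL γ γ.2).2.2 _ (hxL γ) (hx0 γ)
  let f : S × (Fin d → Fin q) → R := fun j => c * x j.1 ^ (q - 1) * ∏ i, z i ^ (j.2 i : ℕ)
  have hf0 : ∀ j, f j ≠ 0 := fun j => mul_ne_zero (mul_ne_zero hc (pow_ne_zero _ (hx0 _)))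
    (Finset.prod_ne_zero_iff.2 fun i _ => pow_ne_zero _ (hz i))
  let M : S × (Fin d → Fin q) → Submodule k R := fun j => (L j.1).map (LinearMap.mulLeft k (f j))
  let δ : S × (Fin d → Fin q) → Γ₁ := fun j => v (f j) * j.1
  have hδ : ∀ j, δ j = v c * (j.1 : Γ₁) ^ q * ∏ i, v (z i) ^ (j.2 i : ℤ) := by
    intro j
    simp only [δ, f, map_mul, map_pow, map_prod, hxv, zpow_natCast]
    obtain ⟨q', rfl⟩ : ∃ q', q = q' + 1 := ⟨q - 1, by omega⟩
    rw [Nat.add_sub_cancel, pow_succ, mul_right_comm, mul_assoc (v c)]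
  have hinj : Function.Injective δ := by
    rintro ⟨γ, β⟩ ⟨γ', β'⟩ h
    rw [hδ, hδ] at h
    simp only at h
    have hvc : v c ≠ 0 := fun h => hc (h0 _ h)
    rw [mul_assoc, mul_assoc] at h
    replace h := mul_left_cancel₀ hvc h
    obtain ⟨μ, hμ⟩ := hexp _ (hx0 γ)
    obtain ⟨μ', hμ'⟩ := hexp _ (hx0 γ')
    rw [hxv] at hμ hμ'
    have hp : ∀ β : Fin d → ℤ, ∏ i, v (z i) ^ β i ≠ 0 := fun β =>
      Finset.prod_ne_zero_iff.2 fun i _ => zpow_ne_zero _ (hvz i)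
    have e1 : ∀ (μ : Fin d → ℤ) (β : Fin d → Fin q) (γ : Γ₁), γ ^ N = ∏ i, v (z i) ^ μ i →
        (γ ^ q * ∏ i, v (z i) ^ ((β i : ℕ) : ℤ)) ^ N =
          ∏ i, v (z i) ^ (μ i * q + (β i : ℕ) * N) := by
      intro μ β γ hh
      rw [mul_pow, ← pow_mul, mul_comm q N, pow_mul, hh, ← Finset.prod_pow, ← Finset.prod_pow,
        ← Finset.prod_mul_distrib]
      refine Finset.prod_congr rfl fun i _ => ?_
      rw [zpow_add₀ (hvz i), zpow_mul, zpow_mul]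
      simp only [zpow_natCast]
    have h2 := congrArg (· ^ N) h
    rw [e1 μ β _ hμ, e1 μ' β' _ hμ'] at h2
    have h3 := hind (fun i => (μ i * q + (β i : ℕ) * N) - (μ' i * q + (β' i : ℕ) * N)) (by
      simp only [zpow_sub₀ (hvz _)]
      rw [Finset.prod_div_distrib, h2, div_self (hp _)])
    have hβ : β = β' := by
      funext i
      have h4 := congrFun h3 i
      simp only [Pi.zero_apply] at h4
      have h5 : (q : ℤ) ∣ (((β i : ℕ) : ℤ) - (β' i : ℕ)) * N := ⟨μ' i - μ i, by linarith⟩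
      have h6 : (q : ℤ) ∣ (((β i : ℕ) : ℤ) - (β' i : ℕ)) :=
        IsCoprime.dvd_of_dvd_mul_right (Nat.isCoprime_iff_coprime.2 hqN) h5
      have h7 := Int.eq_zero_of_abs_lt_dvd h6 (by
        rw [abs_lt]
        have := (β i).2
        have := (β' i).2
        constructor <;> omega)
      apply Fin.ext
      omega
    subst hβ
    have h8 := mul_right_cancel₀ (hp _) h
    have h9 : (γ : Γ₁) = γ' := (pow_left_inj₀ zero_le zero_le hq.ne').1 h8
    rw [Subtype.ext h9]
  have hMW : ∀ j, M j ≤ W := by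
    rintro j _ ⟨y, hy, rfl⟩
    exact hW _ ((hSL j.1 j.1.2).1 (hxL j.1)) _ ((hSL j.1 j.1.2).1 hy) j.2
  have hMδ : ∀ j, ∀ x ∈ M j, x ≠ 0 → v x = δ j := by
    rintro j _ ⟨y, hy, rfl⟩ hne
    rw [LinearMap.mulLeft_apply] at hne ⊢
    rw [map_mul, (hSL j.1 j.1.2).2.2 y hy (right_ne_zero_of_mul hne)]
  have hfin := aux_indep (k := k) v h0 W M hMW δ hinj hMδ
  refine le_trans ?_ hfin
  have hMf : ∀ j, Module.finrank k (M j) = Module.finrank k (L j.1) := by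
    intro j
    exact (LinearEquiv.finrank_eq (Submodule.equivMapOfInjective _ (mul_right_injective₀ (hf0 j)) _)).symm
  simp only [hMf]
  rw [Fintype.sum_prod_type]
  have h10 : ∀ γ : S, ∑ _β : Fin d → Fin q, Module.finrank k (L γ)
      = q ^ d * Module.finrank k (L γ) := by
    intro γ
    simp
  rw [Finset.sum_congr rfl fun γ _ => h10 γ, ← Finset.mul_sum,
    Finset.sum_coe_sort S (fun γ => Module.finrank k (L γ))]
  exact Nat.mul_le_mul_left _ hsum

open scoped Pointwise in
theorem aux_growth {k R : Type*} [Field k] [CommRing R] [Algebra k R] {d : ℕ}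
    (g : MvPolynomial (Fin d) k →ₐ[k] R) (hfin : g.Finite)
    (T : Submodule k R) (hT : T.FG) :
    ∃ C : ℕ, ∀ D : ℕ, Module.finrank k (T ^ D : Submodule k R) ≤ C * (D + 1) ^ d := by
  classical
  let P : ℕ → Finset R := fun n => Finset.univ.image
    (fun β : Fin d → Fin (n + 1) => ∏ i, g (MvPolynomial.X i) ^ (β i : ℕ))
  let Q : ℕ → Submodule k R := fun n => Submodule.span k (P n : Set R)
  have hmemP : ∀ n (β : Fin d → ℕ), (∀ i, β i ≤ n) →
      ∏ i, g (MvPolynomial.X i) ^ β i ∈ P n := by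
    intro n β hβ
    exact Finset.mem_image.2 ⟨fun i => ⟨β i, Nat.lt_succ_of_le (hβ i)⟩, Finset.mem_univ _, rfl⟩
  have hP : ∀ n x, x ∈ P n → ∃ β : Fin d → ℕ, (∀ i, β i ≤ n) ∧
      x = ∏ i, g (MvPolynomial.X i) ^ β i := by
    intro n x hx
    obtain ⟨β, -, rfl⟩ := Finset.mem_image.1 hx
    exact ⟨fun i => β i, fun i => Nat.le_of_lt_succ (β i).2, rfl⟩
  have hPc : ∀ n, (P n).card ≤ (n + 1) ^ d := by
    intro n
    refine Finset.card_image_le.trans ?_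
    simp
  have hQmono : ∀ a b, a ≤ b → Q a ≤ Q b := by
    intro a b hab
    refine Submodule.span_mono fun x hx => ?_
    obtain ⟨β, hβ, rfl⟩ := hP _ _ hx
    exact hmemP _ _ fun i => (hβ i).trans hab
  have hQmul : ∀ a b, Q a * Q b ≤ Q (a + b) := by
    intro a b
    simp only [Q]
    rw [Submodule.span_mul_span]
    refine Submodule.span_mono ?_
    rintro _ ⟨x, hx, y, hy, rfl⟩
    obtain ⟨β, hβ, rfl⟩ := hP _ _ hx
    obtain ⟨β', hβ', rfl⟩ := hP _ _ hy
    simp only [← Finset.prod_mul_distrib, ← pow_add]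
    exact hmemP _ (fun i => β i + β' i) fun i => add_le_add (hβ i) (hβ' i)
  have hQ1 : ∀ n, (1 : R) ∈ Q n := by
    intro n
    have := hmemP n (fun _ => 0) (fun _ => Nat.zero_le _)
    simp only [pow_zero, Finset.prod_const_one] at this
    exact Submodule.subset_span this
  have hg : ∀ p, ∃ n, g p ∈ Q n := by
    intro p
    induction p using MvPolynomial.induction_on with
    | C c =>
      refine ⟨0, ?_⟩
      have : g (MvPolynomial.C c) = c • (1 : R) := by
        rw [← MvPolynomial.algebraMap_eq, AlgHom.commutes, Algebra.algebraMap_eq_smul_one]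
      rw [this]
      exact Submodule.smul_mem _ _ (hQ1 0)
    | add p q hp hq =>
      obtain ⟨a, ha⟩ := hp
      obtain ⟨b, hb⟩ := hq
      refine ⟨a + b, ?_⟩
      rw [map_add]
      exact Submodule.add_mem _ (hQmono _ _ (by omega) ha) (hQmono _ _ (by omega) hb)
    | mul_X p i hp =>
      obtain ⟨a, ha⟩ := hp
      refine ⟨a + 1, hQmul _ _ ?_⟩
      rw [map_mul]
      refine Submodule.mul_mem_mul ha (Submodule.subset_span ?_)
      have := hmemP 1 (fun j => if j = i then 1 else 0) (fun j => by split <;> omega)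
      simpa [Finset.prod_ite_eq', pow_ite] using this
  obtain ⟨u, hu⟩ : ∃ u : Finset R, ∀ x : R, ∃ b, x ∈ Q b * Submodule.span k (u : Set R) := by
    let : Algebra (MvPolynomial (Fin d) k) R := g.toRingHom.toAlgebra
    have hmfin : Module.Finite (MvPolynomial (Fin d) k) R := hfin
    obtain ⟨u, hu⟩ := hmfin.fg_top
    refine ⟨u, fun x => ?_⟩
    have hx : x ∈ Submodule.span (MvPolynomial (Fin d) k) (u : Set R) := hu ▸ Submodule.mem_top
    induction hx using Submodule.span_induction with
    | mem x hx =>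
      refine ⟨0, ?_⟩
      have := Submodule.mul_mem_mul (hQ1 0) (Submodule.subset_span (R := k) hx)
      rwa [one_mul] at this
    | zero => exact ⟨0, Submodule.zero_mem _⟩
    | add x y _ _ hx hy =>
      obtain ⟨a, ha⟩ := hx
      obtain ⟨b, hb⟩ := hy
      exact ⟨a + b, Submodule.add_mem _ (mul_le_mul' (hQmono _ _ (by omega)) le_rfl ha)
        (mul_le_mul' (hQmono _ _ (by omega)) le_rfl hb)⟩
    | smul p x _ hx =>
      obtain ⟨b, hb⟩ := hx
      obtain ⟨a, ha⟩ := hg p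
      refine ⟨a + b, mul_le_mul' (hQmul a b) le_rfl ?_⟩
      rw [mul_assoc]
      exact Submodule.mul_mem_mul ha hb
  set U := Submodule.span k (u : Set R) with hU
  obtain ⟨c, hc⟩ := hu 1
  obtain ⟨b, hb⟩ : ∃ b, T * U ≤ Q b * U := by
    obtain ⟨w, hw⟩ := hT.mul (⟨u, rfl⟩ : U.FG)
    choose B hB using hu
    refine ⟨w.sup B, ?_⟩
    rw [← hw, Submodule.span_le]
    intro x hx
    exact mul_le_mul' (hQmono _ _ (Finset.le_sup hx)) le_rfl (hB x)
  have hpow : ∀ D, T ^ D * U ≤ Q (b * D) * U := by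
    intro D
    induction D with
    | zero =>
      refine mul_le_mul' ?_ le_rfl
      rw [pow_zero, Submodule.one_le]
      exact hQ1 _
    | succ D ih =>
      calc T ^ (D + 1) * U = T ^ D * (T * U) := by rw [pow_succ, mul_assoc]
        _ ≤ T ^ D * (Q b * U) := mul_le_mul' le_rfl hb
        _ = Q b * (T ^ D * U) := by rw [← mul_assoc, mul_comm (T ^ D), mul_assoc]
        _ ≤ Q b * (Q (b * D) * U) := mul_le_mul' le_rfl ih
        _ = (Q b * Q (b * D)) * U := by rw [mul_assoc]
        _ ≤ Q (b * (D + 1)) * U := by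
          refine mul_le_mul' ((hQmul _ _).trans (hQmono _ _ ?_)) le_rfl
          rw [mul_add, mul_one, add_comm]
  refine ⟨(b + c + 1) ^ d * u.card, fun D => ?_⟩
  have hle : T ^ D ≤ Q (c + b * D) * U := by
    calc T ^ D = T ^ D * 1 := (mul_one _).symm
      _ ≤ T ^ D * (Q c * U) := mul_le_mul' le_rfl (Submodule.one_le.2 hc)
      _ = Q c * (T ^ D * U) := by rw [← mul_assoc, mul_comm (T ^ D), mul_assoc]
      _ ≤ Q c * (Q (b * D) * U) := mul_le_mul' le_rfl (hpow D)
      _ = (Q c * Q (b * D)) * U := by rw [mul_assoc]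
      _ ≤ Q (c + b * D) * U := mul_le_mul' (hQmul _ _) le_rfl
  have heq : Q (c + b * D) * U = Submodule.span k ((P (c + b * D) * u : Finset R) : Set R) := by
    simp only [Q, hU]
    rw [Submodule.span_mul_span, Finset.coe_mul]
  rw [heq] at hle
  calc Module.finrank k (T ^ D : Submodule k R)
      ≤ Module.finrank k (Submodule.span k ((P (c + b * D) * u : Finset R) : Set R)) :=
        Submodule.finrank_mono hle
    _ ≤ (P (c + b * D) * u).card := finrank_span_finset_le_card _
    _ ≤ (P (c + b * D)).card * u.card := Finset.card_mul_le
    _ ≤ (c + b * D + 1) ^ d * u.card := Nat.mul_le_mul_right _ (hPc _)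
    _ ≤ ((b + c + 1) * (D + 1)) ^ d * u.card := by
      refine Nat.mul_le_mul_right _ (Nat.pow_le_pow_left ?_ _)
      nlinarith [Nat.zero_le (c * D)]
    _ = (b + c + 1) ^ d * u.card * (D + 1) ^ d := by rw [mul_pow]; ring

theorem aux_limit (σ : ℕ → ℕ) (d N n0 : ℕ) (hN : 0 < N) (C : ℝ)
    (hb : ∀ n : ℕ, 1 ≤ n → (σ n : ℝ) ≤ C * (n : ℝ) ^ d)
    (hkey : ∀ n : ℕ, n0 ≤ n → 1 ≤ n → ∀ t r : ℕ,
      ((N * t + 1 : ℕ) : ℝ) ^ d * ((σ n : ℝ) - C * (n : ℝ) ^ d / n) ≤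
        σ ((N * t + 1) * n + r)) :
    ∃ L : ℝ, Tendsto (fun n : ℕ => (σ n : ℝ) / (n : ℝ) ^ d) atTop (nhds L) := by
  set a : ℕ → ℝ := fun n => (σ n : ℝ) / (n : ℝ) ^ d with ha
  have ha0 : ∀ n, 0 ≤ a n := fun n => by positivity
  have haC : ∀ᶠ n in atTop, a n ≤ C := by
    filter_upwards [eventually_ge_atTop 1] with n hn
    have : (0 : ℝ) < (n : ℝ) ^ d := by positivity
    exact (div_le_iff₀ this).2 (hb n hn)
  have hbu : IsBoundedUnder (· ≤ ·) atTop a := ⟨C, by simpa using haC⟩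
  have hbl : IsBoundedUnder (· ≥ ·) atTop a := ⟨0, by simp [ha0]⟩
  have hstep : ∀ n : ℕ, n0 ≤ n → 1 ≤ n → a n - C / n ≤ liminf a atTop := by
    intro n hn hn1
    have hnp : (0 : ℝ) < n := by exact_mod_cast hn1
    have h1 : ∀ m : ℕ, N * n ≤ m → n ≤ m →
        (1 - (N * n : ℝ) / m) ^ d * (a n - C / n) ≤ a m := by
      intro m hm1 hm2
      have hmp : (0 : ℝ) < m := lt_of_lt_of_le hnp (by exact_mod_cast hm2)
      have h01 : 0 ≤ 1 - (N * n : ℝ) / m := by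
        rw [sub_nonneg, div_le_one hmp]
        exact_mod_cast hm1
      rcases le_total (a n - C / n) 0 with hneg | hpos
      · exact le_trans (mul_nonpos_of_nonneg_of_nonpos (pow_nonneg h01 d) hneg) (ha0 m)
      · let t := (m - n) / (N * n)
        let r := (m - n) % (N * n)
        have hmr : (N * t + 1) * n + r = m := by
          have := Nat.div_add_mod (m - n) (N * n)
          have h3 : N * n * t + r = m - n := this
          have : (N * t + 1) * n + r = N * n * t + r + n := by ring
          omega
        have hr : r < N * n := Nat.mod_lt _ (by positivity)
        have h4 := hkey n hn hn1 t r
        rw [hmr] at h4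
        have hq : 1 - (N * n : ℝ) / m ≤ ((N * t + 1 : ℕ) : ℝ) * n / m := by
          rw [le_div_iff₀ hmp, sub_mul, div_mul_cancel₀ _ hmp.ne', one_mul]
          have h5 : (m : ℝ) = ((N * t + 1 : ℕ) : ℝ) * n + r := by exact_mod_cast hmr.symm
          have h6 : (r : ℝ) ≤ N * n := by exact_mod_cast hr.le
          linarith
        calc (1 - (N * n : ℝ) / m) ^ d * (a n - C / n)
            ≤ (((N * t + 1 : ℕ) : ℝ) * n / m) ^ d * (a n - C / n) := by gcongr
          _ = ((N * t + 1 : ℕ) : ℝ) ^ d * ((σ n : ℝ) - C * (n : ℝ) ^ d / n) / (m : ℝ) ^ d := by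
            simp only [ha, div_pow, mul_pow]
            field_simp
          _ ≤ a m := by
            simp only [ha]
            gcongr
    have h2 : Tendsto (fun m : ℕ => (1 - (N * n : ℝ) / m) ^ d * (a n - C / n)) atTop
        (nhds ((1 - 0) ^ d * (a n - C / n))) :=
      ((tendsto_const_nhds.sub (tendsto_const_div_atTop_nhds_zero_nat _)).pow d).mul_const _
    rw [sub_zero, one_pow, one_mul] at h2
    rw [← h2.liminf_eq]
    refine liminf_le_liminf ?_ h2.isBoundedUnder_ge hbu.isCoboundedUnder_ge
    filter_upwards [eventually_ge_atTop (N * n), eventually_ge_atTop n] with m hm1 hm2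
    exact h1 m hm1 hm2
  refine ⟨liminf a atTop, tendsto_of_le_liminf_of_limsup_le le_rfl ?_ hbu hbl⟩
  have h3 : Tendsto (fun n : ℕ => liminf a atTop + C / n) atTop (nhds (liminf a atTop + 0)) :=
    tendsto_const_nhds.add (tendsto_const_div_atTop_nhds_zero_nat _)
  rw [add_zero] at h3
  conv_rhs => rw [← h3.limsup_eq]
  refine limsup_le_limsup ?_ hbl.isCoboundedUnder_le h3.isBoundedUnder_le
  filter_upwards [eventually_ge_atTop n0, eventually_ge_atTop 1] with n hn hn1
  have := hstep n hn hn1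
  linarith

theorem aux_T {k R : Type*} [Field k] [CommRing R] [Algebra k R]
    (𝒜 : ℕ → Submodule k R) [GradedAlgebra 𝒜]
    (hFG : Algebra.FiniteType k R) (hstd : Algebra.adjoin k (𝒜 1 : Set R) = ⊤) :
    ∃ T : Submodule k R, T.FG ∧ ∀ i D : ℕ, i ≤ D → 𝒜 i ≤ T ^ D := by
  classical
  have h1 : ∀ x : R, ∃ t : Finset R, (t : Set R) ⊆ 𝒜 1 ∧ x ∈ Algebra.adjoin k (t : Set R) := by
    intro x
    have hx : x ∈ Algebra.adjoin k (𝒜 1 : Set R) := hstd ▸ Algebra.mem_top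
    induction hx using Algebra.adjoin_induction with
    | mem x hx => exact ⟨{x}, by simpa using hx, Algebra.subset_adjoin (by simp)⟩
    | algebraMap r => exact ⟨∅, by simp, Subalgebra.algebraMap_mem _ _⟩
    | add x y _ _ hx hy =>
      obtain ⟨s, hs, hs'⟩ := hx
      obtain ⟨t, ht, ht'⟩ := hy
      refine ⟨s ∪ t, by simp [hs, ht], Subalgebra.add_mem _ (Algebra.adjoin_mono ?_ hs')
        (Algebra.adjoin_mono ?_ ht')⟩ <;> simp
    | mul x y _ _ hx hy =>
      obtain ⟨s, hs, hs'⟩ := hx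
      obtain ⟨t, ht, ht'⟩ := hy
      refine ⟨s ∪ t, by simp [hs, ht], Subalgebra.mul_mem _ (Algebra.adjoin_mono ?_ hs')
        (Algebra.adjoin_mono ?_ ht')⟩ <;> simp
  obtain ⟨t, ht, ht'⟩ : ∃ t : Finset R, (t : Set R) ⊆ 𝒜 1 ∧
      Algebra.adjoin k (t : Set R) = ⊤ := by
    obtain ⟨s, hs⟩ := hFG.out
    choose B hB hB' using h1
    refine ⟨s.biUnion B, ?_, ?_⟩
    · intro x hx
      obtain ⟨y, -, hy⟩ := Finset.mem_biUnion.1 hx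
      exact hB y hy
    · rw [eq_top_iff, ← hs, Algebra.adjoin_le_iff]
      intro x hx
      refine Algebra.adjoin_mono ?_ (hB' x)
      exact_mod_cast Finset.subset_biUnion_of_mem B hx
  set V := Submodule.span k (t : Set R) with hV
  have hVA : ∀ i, V ^ i ≤ 𝒜 i := by
    intro i
    induction i with
    | zero =>
      rw [pow_zero, Submodule.one_le]
      exact SetLike.GradedOne.one_mem
    | succ i ih =>
      rw [pow_succ, Submodule.mul_le]
      intro x hx y hy
      exact SetLike.GradedMul.mul_mem (ih hx) ((Submodule.span_le.2 ht : V ≤ 𝒜 1) hy)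
  have htop : ⨆ i, V ^ i = ⊤ := by
    rw [eq_top_iff]
    intro x _
    have hx : x ∈ Algebra.adjoin k (t : Set R) := ht' ▸ Algebra.mem_top
    induction hx using Algebra.adjoin_induction with
    | mem x hx =>
      refine Submodule.mem_iSup_of_mem 1 ?_
      rw [pow_one]
      exact Submodule.subset_span hx
    | algebraMap r =>
      refine Submodule.mem_iSup_of_mem 0 ?_
      rw [pow_zero]
      exact Submodule.algebraMap_mem r
    | add x y _ _ hx hy => exact Submodule.add_mem _ (hx trivial) (hy trivial)
    | mul x y _ _ hx hy =>
      have h := Submodule.mul_mem_mul (hx trivial) (hy trivial)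
      refine (?_ : (⨆ i, V ^ i) * (⨆ i, V ^ i) ≤ ⨆ i, V ^ i) h
      rw [Submodule.iSup_mul]
      refine iSup_le fun i => ?_
      rw [Submodule.mul_iSup]
      refine iSup_le fun j => ?_
      rw [← pow_add]
      exact le_iSup (fun i => V ^ i) (i + j)
  have hind : iSupIndep 𝒜 := (DirectSum.Decomposition.isInternal 𝒜).submodule_iSupIndep
  have heq := hind.le_iff_eq_of_iSup_eq_top htop
  have heq' := heq.1 hVA
  refine ⟨1 ⊔ V, ?_, fun i D hiD => ?_⟩
  · exact Submodule.FG.sup ⟨{1}, by simp [Submodule.one_eq_span]⟩ ⟨t, rfl⟩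
  · rw [← heq']
    exact (pow_le_pow_left' le_sup_right i).trans (pow_le_pow_right' le_sup_left hiD)

theorem aux_mem_sat {R : Type*} [CommRing R] (I J : Ideal R) (x : R) :
    x ∈ sat I J ↔ ∃ j : ℕ, ∀ y ∈ J ^ j, x * y ∈ I := by
  unfold sat
  rw [Submodule.mem_iSup_of_directed]
  · simp only [Submodule.mem_colon, smul_eq_mul, SetLike.mem_coe]
  · intro a b
    refine ⟨a + b, ?_, ?_⟩ <;> intro x hx <;> rw [Submodule.mem_colon] at hx ⊢ <;>
      intro y hy <;> apply hx
    · exact Ideal.pow_le_pow_right (Nat.le_add_right _ _) hy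
    · exact Ideal.pow_le_pow_right (Nat.le_add_left _ _) hy

theorem aux_le_sat {R : Type*} [CommRing R] (I J : Ideal R) : I ≤ sat I J := by
  intro x hx
  exact (aux_mem_sat I J x).2 ⟨0, fun y _ => I.mul_mem_right y hx⟩

theorem aux_sat_mul {R : Type*} [CommRing R] (I m : Ideal R) (n n' : ℕ) {x y : R}
    (hx : x ∈ sat (I ^ n) m) (hy : y ∈ sat (I ^ n') m) : x * y ∈ sat (I ^ (n + n')) m := by
  obtain ⟨j, hj⟩ := (aux_mem_sat _ _ _).1 hx
  obtain ⟨j', hj'⟩ := (aux_mem_sat _ _ _).1 hy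
  refine (aux_mem_sat _ _ _).2 ⟨j + j', fun w hw => ?_⟩
  rw [pow_add] at hw ⊢
  refine Submodule.mul_induction_on hw (fun a ha b hb => ?_) (fun a b ha hb => ?_)
  · rw [mul_mul_mul_comm]
    exact Ideal.mul_mem_mul (hj a ha) (hj' b hb)
  · rw [mul_add]
    exact Ideal.add_mem _ ha hb

noncomputable def auxU {k R : Type*} [Field k] [CommRing R] [Algebra k R]
    (𝒜 : ℕ → Submodule k R) (J : Ideal R) (D : ℕ) : Submodule k R :=
  (Finset.range (D + 1)).sup (piece 𝒜 J)

theorem aux_U_mul {k R : Type*} [Field k] [CommRing R] [Algebra k R]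
    (𝒜 : ℕ → Submodule k R) [GradedAlgebra 𝒜] (J J' J'' : Ideal R)
    (hJ : ∀ x ∈ J, ∀ y ∈ J', x * y ∈ J'') (D D' : ℕ) {x y : R}
    (hx : x ∈ auxU 𝒜 J D) (hy : y ∈ auxU 𝒜 J' D') : x * y ∈ auxU 𝒜 J'' (D + D') := by
  have h := Submodule.mul_mem_mul hx hy
  refine (?_ : auxU 𝒜 J D * auxU 𝒜 J' D' ≤ auxU 𝒜 J'' (D + D')) h
  unfold auxU
  rw [Finset.sup_eq_iSup, Finset.sup_eq_iSup]
  simp only [Submodule.iSup_mul, Submodule.mul_iSup]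
  refine iSup_le fun j => iSup_le fun hj => iSup_le fun i => iSup_le fun hi => ?_
  rw [Finset.mem_range] at hi hj
  have hle : piece 𝒜 J'' (i + j) ≤ (Finset.range (D + D' + 1)).sup (piece 𝒜 J'') :=
    Finset.le_sup (Finset.mem_range.2 (by omega))
  refine le_trans ?_ hle
  rw [Submodule.mul_le]
  rintro a ⟨ha, ha'⟩ b ⟨hb, hb'⟩
  exact ⟨hJ a ha b hb, SetLike.GradedMul.mul_mem ha' hb'⟩

theorem aux_U_mono {k R : Type*} [Field k] [CommRing R] [Algebra k R]
    (𝒜 : ℕ → Submodule k R) (J : Ideal R) {D D' : ℕ} (h : D ≤ D') :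
    auxU 𝒜 J D ≤ auxU 𝒜 J D' :=
  Finset.sup_mono (Finset.range_mono (by omega))

theorem aux_finrank_sup {k R : Type*} [Field k] [CommRing R] [Algebra k R]
    (B : ℕ → Submodule k R) (hB : iSupIndep B) (hfd : ∀ i, FiniteDimensional k (B i)) (n : ℕ) :
    Module.finrank k ((Finset.range n).sup B : Submodule k R) =
      ∑ i ∈ Finset.range n, Module.finrank k (B i) := by
  induction n with
  | zero => rw [Finset.range_zero, Finset.sup_empty, finrank_bot, Finset.sum_empty]
  | succ n ih =>
    have hdis : Disjoint (B n) ((Finset.range n).sup B) := by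
      have := hB n
      refine this.mono_right (Finset.sup_le fun i hi => ?_)
      refine le_iSup₂_of_le i ?_ le_rfl
      rw [Finset.mem_range] at hi
      omega
    rw [Finset.sum_range_succ, ← ih, Finset.range_add_one, Finset.sup_insert]
    have hfd' : FiniteDimensional k ((Finset.range n).sup B : Submodule k R) :=
      Submodule.finite_finset_sup _ _
    have h1 := Submodule.finrank_sup_add_finrank_inf_eq (B n) ((Finset.range n).sup B)
    rw [hdis.eq_bot, finrank_bot] at h1
    omega

theorem aux_shell (h : ℕ → ℕ) (p : ℕ) (hp : 0 < p) (hmono : ∀ i, h i ≤ h (i + p)) (C d : ℕ)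
    (hC : ∀ D, ∑ i ∈ Finset.range (D + 1), h i ≤ C * (D + 1) ^ d) (i n : ℕ) :
    n * h i ≤ C * (i + n * p + 1) ^ d := by
  classical
  have h1 : ∀ t, h i ≤ h (i + t * p) := by
    intro t
    induction t with
    | zero => simp
    | succ t ih =>
      refine ih.trans ((hmono _).trans (le_of_eq ?_))
      congr 1
      ring
  have hinj : Function.Injective (fun t => i + t * p) := by
    intro a b hab
    have : a * p = b * p := by simpa using hab
    exact Nat.eq_of_mul_eq_mul_right hp this
  calc n * h i = ∑ t ∈ Finset.range n, h i := by simp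
    _ ≤ ∑ t ∈ Finset.range n, h (i + t * p) := Finset.sum_le_sum fun t _ => h1 t
    _ = ∑ j ∈ (Finset.range n).image (fun t => i + t * p), h j :=
        (Finset.sum_image (f := h) (fun a _ b _ hab => hinj hab)).symm
    _ ≤ ∑ j ∈ Finset.range (i + n * p + 1), h j := by
        refine Finset.sum_le_sum_of_subset fun j hj => ?_
        obtain ⟨t, ht, rfl⟩ := Finset.mem_image.1 hj
        rw [Finset.mem_range] at ht ⊢
        have := Nat.mul_le_mul_right p ht.le
        omega
    _ ≤ _ := hC _

theorem aux_noether (k R : Type) [Field k] [CommRing R] [IsDomain R] [Algebra k R]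
    (hFG : Algebra.FiniteType k R) (d : ℕ) (hd : ringKrullDim R = d) :
    ∃ g : MvPolynomial (Fin d) k →ₐ[k] R, Function.Injective g ∧ g.Finite := by
  obtain ⟨s, g, hg, hfin⟩ := exists_finite_inj_algHom_of_fg k R
  have hs : s = d := by
    let : Algebra (MvPolynomial (Fin s) k) R := g.toRingHom.toAlgebra
    have hmfin : Module.Finite (MvPolynomial (Fin s) k) R := hfin
    have h1 := aux_krullDim_eq (S := MvPolynomial (Fin s) k) (R := R) hg
    rw [MvPolynomial.ringKrullDim_of_isNoetherianRing, ringKrullDim_eq_zero_of_field, hd,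
      zero_add, Nat.card_fin] at h1
    exact_mod_cast h1.symm
  subst hs
  exact ⟨g, hg, hfin⟩

theorem aux_mem_U {k R : Type*} [Field k] [CommRing R] [Algebra k R]
    (𝒜 : ℕ → Submodule k R) (J : Ideal R) {i D : ℕ} (hi : i ≤ D) {x : R}
    (hx : x ∈ J) (hx' : x ∈ 𝒜 i) : x ∈ auxU 𝒜 J D :=
  (Finset.le_sup (f := piece 𝒜 J) (Finset.mem_range.2 (Nat.lt_succ_of_le hi))) ⟨hx, hx'⟩

theorem aux_exists_U {k R : Type*} [Field k] [CommRing R] [Algebra k R]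
    (𝒜 : ℕ → Submodule k R) [GradedAlgebra 𝒜] (J : Ideal R) (hJ : J = ⊤) (x : R) :
    ∃ D, x ∈ auxU 𝒜 J D := by
  classical
  refine ⟨(DFinsupp.support (DirectSum.decompose 𝒜 x)).sup id, ?_⟩
  have hsum := DirectSum.sum_support_decompose 𝒜 x
  suffices h : ∑ i ∈ DFinsupp.support (DirectSum.decompose 𝒜 x),
      ((DirectSum.decompose 𝒜 x i : 𝒜 i) : R) ∈
      auxU 𝒜 J ((DFinsupp.support (DirectSum.decompose 𝒜 x)).sup id) by rwa [hsum] at h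
  refine Submodule.sum_mem _ fun i hi => ?_
  exact aux_mem_U 𝒜 J (Finset.le_sup (f := id) hi) (hJ ▸ Submodule.mem_top) (SetLike.coe_mem _)

theorem aux_exists_hom {k R : Type*} [Field k] [CommRing R] [IsDomain R] [Algebra k R]
    (𝒜 : ℕ → Submodule k R) [GradedAlgebra 𝒜] (a : R)
    (ha : a ∈ (HomogeneousIdeal.irrelevant 𝒜).toIdeal) (ha0 : a ≠ 0) :
    ∃ p, 0 < p ∧ ∃ w ∈ 𝒜 p, w ≠ 0 := by
  classical
  have h1 : GradedRing.proj 𝒜 0 a = 0 := (HomogeneousIdeal.mem_irrelevant_iff 𝒜 a).1 ha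
  by_contra hcon
  push Not at hcon
  apply ha0
  rw [← DirectSum.sum_support_decompose 𝒜 a]
  refine Finset.sum_eq_zero fun i _ => ?_
  rcases Nat.eq_zero_or_pos i with rfl | hi
  · exact h1
  · exact hcon i hi _ (SetLike.coe_mem _)

theorem aux_exists_gen {R : Type*} [CommRing R] [IsDomain R] (I : Ideal R)
    (hht : 1 ≤ idealHeight I) (s : Finset R) (hs : I = Ideal.span ↑s) : ∃ f ∈ s, f ≠ 0 := by
  by_contra hcon
  push Not at hcon
  have hI : I = ⊥ := by
    rw [hs, Ideal.span_eq_bot]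
    exact fun x hx => hcon x hx
  have h1 : idealHeight I ≤ Order.height (⟨⊥, Ideal.isPrime_bot⟩ : PrimeSpectrum R) :=
    iInf₂_le (f := fun (p : PrimeSpectrum R) (_ : I ≤ p.asIdeal) => Order.height p)
      (⟨⊥, Ideal.isPrime_bot⟩ : PrimeSpectrum R) (le_of_eq hI)
  have h2 : Order.height (⟨⊥, Ideal.isPrime_bot⟩ : PrimeSpectrum R) = 0 := by
    rw [Order.height_eq_zero]
    intro q _
    exact (bot_le : (⊥ : Ideal R) ≤ q.asIdeal)
  rw [h2] at h1
  have := hht.trans h1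
  simp at this

set_option maxHeartbeats 1000000 in
theorem statement17 (k : Type) [Field k] [CharZero k]
    (R : Type) [CommRing R] [IsDomain R] [Algebra k R]
    (𝒜 : ℕ → Submodule k R) [GradedAlgebra 𝒜]
    -- `R` is a quotient of a polynomial ring by a homogeneous prime ideal
    (hFG : Algebra.FiniteType k R)
    (hstd : Algebra.adjoin k (𝒜 1 : Set R) = ⊤)
    (m : Ideal R) (hm : m = (HomogeneousIdeal.irrelevant 𝒜).toIdeal)
    (d : ℕ) (hd : ringKrullDim R = d)
    -- `depth (R_m) ≥ 2`
    (hdepth : ∃ a b : R, a ∈ m ∧ b ∈ m ∧ RingTheory.Sequence.IsRegular R [a, b])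
    -- a homogeneous ideal of height at least 1
    (I : Ideal R) (hI : I.IsHomogeneous 𝒜) (hht : 1 ≤ idealHeight I)
    -- `e` exceeds the degrees of a set of homogeneous generators of `I` …
    (e : ℕ)
    (hgen : ∃ s : Finset R, (∀ f ∈ s, ∃ i < e, f ∈ 𝒜 i) ∧ I = Ideal.span ↑s)
    -- … and the Swanson linear bound: `(Iⁿ)_m = ((Iⁿ)^*)_m` for `m ≥ en`, `n ≥ 1`
    (hSwanson : ∀ n : ℕ, 1 ≤ n → ∀ i : ℕ, e * n ≤ i →
      piece 𝒜 (sat (I ^ n) m) i = piece 𝒜 (I ^ n) i) :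
    -- `σ(n) = Σ_{i=0}^{en} dim_k ((Iⁿ)^*)_i` and `lim σ(n)/n^d` exists
    ∃ L : ℝ,
      Tendsto (fun n : ℕ =>
          ((∑ i ∈ Finset.range (e * n + 1),
            Module.finrank k (piece 𝒜 (sat (I ^ n) m) i) : ℕ) : ℝ) / (n : ℝ) ^ d)
        atTop (nhds L) := by
  classical
  obtain ⟨g, hg, hfin⟩ := aux_noether k R hFG d hd
  obtain ⟨Γ₁, _, v, N, hN, hk, h0, hind, hexp⟩ := aux_val_R g hg hfin
  obtain ⟨T, hTfg, hT⟩ := aux_T 𝒜 hFG hstd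
  obtain ⟨C, hC⟩ := aux_growth g hfin T hTfg
  have hTfd : ∀ D, FiniteDimensional k (T ^ D : Submodule k R) :=
    fun D => Module.Finite.iff_fg.2 (hTfg.pow D)
  have hAfd : ∀ i, FiniteDimensional k (𝒜 i) :=
    fun i => Submodule.finiteDimensional_of_le (hT i i le_rfl)
  have hpfd : ∀ (J : Ideal R) i, FiniteDimensional k (piece 𝒜 J i) :=
    fun J i => Submodule.finiteDimensional_of_le (inf_le_right : piece 𝒜 J i ≤ 𝒜 i)
  have hUfd : ∀ (J : Ideal R) D, FiniteDimensional k (auxU 𝒜 J D) :=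
    fun J D => Submodule.finite_finset_sup _ _
  have hAind : iSupIndep 𝒜 := (DirectSum.Decomposition.isInternal 𝒜).submodule_iSupIndep
  have hUrank : ∀ (J : Ideal R) D, Module.finrank k (auxU 𝒜 J D) =
      ∑ i ∈ Finset.range (D + 1), Module.finrank k (piece 𝒜 J i) := fun J D =>
    aux_finrank_sup _ (hAind.mono fun i => inf_le_right) (hpfd J) _
  let h : ℕ → ℕ := fun i => Module.finrank k (𝒜 i)
  have hpiece : ∀ (J : Ideal R) i, Module.finrank k (piece 𝒜 J i) ≤ h i :=
    fun J i => Submodule.finrank_mono (inf_le_right : piece 𝒜 J i ≤ 𝒜 i)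
  have hhC : ∀ D, ∑ i ∈ Finset.range (D + 1), h i ≤ C * (D + 1) ^ d := by
    intro D
    rw [← aux_finrank_sup 𝒜 hAind hAfd (D + 1)]
    refine le_trans (Submodule.finrank_mono ?_) (hC D)
    refine Finset.sup_le fun i hi => hT i D ?_
    rw [Finset.mem_range] at hi
    omega
  -- a nonzero homogeneous element of positive degree
  obtain ⟨p, hp, w, hwp, hw0⟩ : ∃ p, 0 < p ∧ ∃ w ∈ 𝒜 p, w ≠ 0 := by
    obtain ⟨a, b, ha, -, hreg⟩ := hdepth
    refine aux_exists_hom 𝒜 a (hm ▸ ha) ?_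
    rintro rfl
    have h1 := ((RingTheory.Sequence.isWeaklyRegular_cons_iff R _ _).1 hreg.toIsWeaklyRegular).1
    have h2 : (0 : R) = 1 := h1 (by simp)
    exact zero_ne_one h2
  have hhmono : ∀ i, h i ≤ h (i + p) := by
    intro i
    have h1 : (𝒜 i).map (LinearMap.mulLeft k w) ≤ 𝒜 (i + p) := by
      rintro _ ⟨y, hy, rfl⟩
      rw [LinearMap.mulLeft_apply, mul_comm]
      exact SetLike.GradedMul.mul_mem hy hwp
    have h2 : Module.finrank k ((𝒜 i).map (LinearMap.mulLeft k w)) = h i :=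
      (LinearEquiv.finrank_eq (Submodule.equivMapOfInjective _
        (mul_right_injective₀ hw0) _)).symm
    rw [← h2]
    exact Submodule.finrank_mono h1
  -- a nonzero homogeneous generator of `I`
  obtain ⟨s, hs, hIs⟩ := hgen
  obtain ⟨f, hfs, hf0⟩ := aux_exists_gen I hht s hIs
  obtain ⟨i0, hi0, hfi0⟩ := hs f hfs
  have hfI : f ∈ I := hIs ▸ Ideal.subset_span hfs
  let P : ℕ → ℕ → Submodule k R := fun n D => auxU 𝒜 (sat (I ^ n) m) D
  have hPmul : ∀ {n n' D D' : ℕ} {x y : R}, x ∈ P n D → y ∈ P n' D' →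
      x * y ∈ P (n + n') (D + D') := by
    intro n n' D D' x y hx hy
    exact aux_U_mul 𝒜 _ _ _ (fun a ha b hb => aux_sat_mul I m n n' ha hb) D D' hx hy
  have hP1 : (1 : R) ∈ P 0 0 :=
    aux_mem_U 𝒜 _ le_rfl (aux_le_sat _ _ (by simp)) SetLike.GradedOne.one_mem
  have hPpow : ∀ {n D : ℕ} {x : R}, x ∈ P n D → ∀ j, x ^ j ∈ P (n * j) (D * j) := by
    intro n D x hx j
    induction j with
    | zero => simpa using hP1
    | succ j ih =>
      rw [pow_succ, mul_add, mul_add, mul_one, mul_one]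
      exact hPmul ih hx
  have hPmono : ∀ {n D D' : ℕ}, D ≤ D' → P n D ≤ P n D' := fun hD => aux_U_mono 𝒜 _ hD
  have hfr : ∀ r, f ^ r ∈ P r (e * r) := by
    intro r
    refine aux_mem_U 𝒜 _ ?_ (aux_le_sat _ _ (Ideal.pow_mem_pow hfI r))
      (SetLike.pow_mem_graded r hfi0)
    rw [smul_eq_mul, mul_comm]
    exact Nat.mul_le_mul_right _ hi0.le
  obtain ⟨b, hb⟩ : ∃ b, ∀ i, g (MvPolynomial.X i) ∈ P 0 b := by
    have htop : sat (I ^ 0) m = ⊤ := by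
      rw [eq_top_iff]
      exact le_trans (by simp) (aux_le_sat (I ^ 0) m)
    choose B hB using fun i : Fin d => aux_exists_U 𝒜 (sat (I ^ 0) m) htop (g (MvPolynomial.X i))
    exact ⟨Finset.univ.sup B, fun i => hPmono (Finset.le_sup (Finset.mem_univ i)) (hB i)⟩
  have hprod : ∀ (q : ℕ) (β : Fin d → Fin q),
      ∏ i, g (MvPolynomial.X i) ^ (β i : ℕ) ∈ P 0 (d * b * q) := by
    intro q β
    have h1 : ∀ t : Finset (Fin d), ∏ i ∈ t, g (MvPolynomial.X i) ^ (β i : ℕ) ∈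
        P 0 (t.card * (b * q)) := by
      intro t
      induction t using Finset.induction_on with
      | empty => simpa using hP1
      | insert i t hit ih =>
        rw [Finset.prod_insert hit, Finset.card_insert_of_notMem hit, add_mul, one_mul, add_comm]
        have h2 := hPpow (hb i) (β i : ℕ)
        rw [zero_mul] at h2
        have h4 : g (MvPolynomial.X i) ^ (β i : ℕ) ∈ P 0 (b * q) :=
          hPmono (Nat.mul_le_mul_left b (β i).2.le) h2
        have h5 := hPmul h4 ih
        rw [zero_add] at h5
        exact h5
    have h3 := h1 Finset.univ
    rwa [Finset.card_univ, Fintype.card_fin, ← mul_assoc] at h3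
  -- the key inequality
  have hkey : ∀ n, d * b ≤ e * n → ∀ t r : ℕ,
      (N * t + 1) ^ d * Module.finrank k (P n (e * n - d * b)) ≤
        Module.finrank k (P ((N * t + 1) * n + r) (e * ((N * t + 1) * n + r))) := by
    intro n hn t r
    have hPfd1 : FiniteDimensional k (P n (e * n - d * b)) := hUfd _ _
    have hPfd2 : FiniteDimensional k
      (P ((N * t + 1) * n + r) (e * ((N * t + 1) * n + r))) := hUfd _ _
    refine aux_key v N (fun i => g (MvPolynomial.X i)) hk h0 hind ?_ hexp (N * t + 1)
      (Nat.succ_pos _) (by simp) _ _ (f ^ r) (pow_ne_zero _ hf0) ?_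
    · intro i hi
      exact MvPolynomial.X_ne_zero i (hg (hi.trans (map_zero g).symm))
    · intro x hx y hy β
      have h1 := hPmul (hPmul (hPmul (hfr r) (hPpow hx (N * t + 1 - 1))) (hprod _ β)) hy
      rw [Nat.add_sub_cancel] at h1 ⊢
      obtain ⟨D, hD⟩ : ∃ D, e * n = D + d * b := ⟨e * n - d * b, by omega⟩
      have e1 : r + n * (N * t) + 0 + n = (N * t + 1) * n + r := by ring
      have e2 : e * r + (e * n - d * b) * (N * t) + d * b * (N * t + 1) + (e * n - d * b) =
          e * ((N * t + 1) * n + r) := by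
        have e3 : e * n - d * b = D := by omega
        rw [e3]
        calc _ = (D + d * b) * (N * t + 1) + e * r := by ring
          _ = _ := by rw [← hD]; ring
      rwa [e1, e2] at h1
  -- assembling the limit
  let σ : ℕ → ℕ := fun n => ∑ i ∈ Finset.range (e * n + 1),
    Module.finrank k (piece 𝒜 (sat (I ^ n) m) i)
  have hσ : ∀ n, σ n = Module.finrank k (P n (e * n)) := fun n => (hUrank _ _).symm
  have hpowle : ∀ n c : ℕ, 1 ≤ n → C * (e * n + n * c + 1) ^ d ≤ C * (e + c + 1) ^ d * n ^ d := by
    intro n c hn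
    rw [mul_assoc, ← mul_pow]
    refine Nat.mul_le_mul_left _ (Nat.pow_le_pow_left ?_ _)
    nlinarith
  have hshell : ∀ n, d * b ≤ e * n → 1 ≤ n → n * σ n ≤
      n * Module.finrank k (P n (e * n - d * b)) + d * b * (C * (e + p + 1) ^ d * n ^ d) := by
    intro n hn hn1
    have h1 : e * n + 1 = (e * n - d * b + 1) + d * b := by omega
    have h2 : σ n = Module.finrank k (P n (e * n - d * b)) + ∑ j ∈ Finset.range (d * b),
        Module.finrank k (piece 𝒜 (sat (I ^ n) m) (e * n - d * b + 1 + j)) := by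
      simp only [σ, P]
      rw [h1, Finset.sum_range_add, hUrank]
    rw [h2, mul_add, Finset.mul_sum]
    refine Nat.add_le_add_left ?_ _
    refine (Finset.sum_le_card_nsmul _ _ (C * (e + p + 1) ^ d * n ^ d) fun j hj => ?_).trans ?_
    · rw [Finset.mem_range] at hj
      refine (Nat.mul_le_mul_left _ (hpiece _ _)).trans
        ((aux_shell h p hp hhmono C d hhC _ n).trans ?_)
      refine le_trans ?_ (hpowle n p hn1)
      refine Nat.mul_le_mul_left _ (Nat.pow_le_pow_left ?_ _)
      omega
    · rw [Finset.card_range, smul_eq_mul]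
  have hupper : ∀ n, 1 ≤ n → σ n ≤ C * (e + p + 1) ^ d * n ^ d := by
    intro n hn
    refine (Finset.sum_le_sum fun i _ => hpiece _ i).trans ((hhC (e * n)).trans ?_)
    refine le_trans ?_ (hpowle n p hn)
    refine Nat.mul_le_mul_left _ (Nat.pow_le_pow_left ?_ _)
    omega
  have hebig : ∀ n, d * b ≤ n → d * b ≤ e * n := by
    intro n hn
    have : 1 * n ≤ e * n := Nat.mul_le_mul_right n (by omega)
    omega
  refine aux_limit σ d N (d * b) hN (((d * b + 1) * (C * (e + p + 1) ^ d) : ℕ) : ℝ) ?_ ?_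
  · intro n hn
    have h1 : σ n ≤ (d * b + 1) * (C * (e + p + 1) ^ d) * n ^ d := by
      refine (hupper n hn).trans (Nat.mul_le_mul_right _ ?_)
      exact Nat.le_mul_of_pos_left _ (Nat.succ_pos _)
    exact_mod_cast h1
  · intro n hn hn1 t r
    have h1 := hkey n (hebig n hn) t r
    have h2 : n * σ n ≤ n * Module.finrank k (P n (e * n - d * b)) +
        (d * b + 1) * (C * (e + p + 1) ^ d) * n ^ d := by
      refine (hshell n (hebig n hn) hn1).trans (Nat.add_le_add_left ?_ _)
      rw [← mul_assoc]
      exact Nat.mul_le_mul_right _ (Nat.mul_le_mul_right _ (Nat.le_succ _))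
    rw [← hσ] at h1
    have hnp : (0 : ℝ) < n := by exact_mod_cast hn1
    have h3 : (σ n : ℝ) - (((d * b + 1) * (C * (e + p + 1) ^ d) : ℕ) : ℝ) * (n : ℝ) ^ d / n ≤
        (Module.finrank k (P n (e * n - d * b)) : ℝ) := by
      rw [sub_le_iff_le_add, ← sub_le_iff_le_add', le_div_iff₀ hnp]
      have h4 : (n : ℝ) * σ n ≤ n * (Module.finrank k (P n (e * n - d * b)) : ℝ) +
        (((d * b + 1) * (C * (e + p + 1) ^ d) : ℕ) : ℝ) * (n : ℝ) ^ d := by exact_mod_cast h2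
      linarith
    refine (mul_le_mul_of_nonneg_left h3 (by positivity)).trans ?_
    exact_mod_cast h1
end
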